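/- In the proof of the Kunen-style theorem: let j : M → N be elementary between transitive ZFC models with the same ordinals, with critical sequence bounded, with j[α] ∈ N for all α, and with M and N agreeing on regularity. Let λ be the supremum of the critical sequence. Then λ has cofinality ω in both M and N, j(λ) = λ, and j((λ⁺)^M) = (λ⁺)^M. -/

import Mathlib

open FirstOrder FirstOrder.Language

/-- The language of set theory: one binary relation symbol. -/
def ZFLang : FirstOrder.Language :=
  ⟨fun _ => Empty, fun n => match n with | 2 => Unit | _ => Empty⟩

def memRel : ZFLang.Relations 2 := ()

/-- The membership structure on a class of ZF-sets. -/
noncomputable instance zfStr (M : Set ZFSet) : ZFLang.Structure ↥M where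
  funMap {n} f _ := f.elim
  RelMap {n} r v :=
    match n, r, v with
    | 2, _, v => ((v 0 : ↥M) : ZFSet) ∈ ((v 1 : ↥M) : ZFSet)
    | 0, r, _ => r.elim
    | 1, r, _ => r.elim
    | (_+3), r, _ => r.elim

/-- The formula `x ∈ y`. -/
def mem' {n : ℕ} (x y : Fin n) : ZFLang.BoundedFormula Empty n :=
  Relations.boundedFormula₂ memRel (Term.var (Sum.inr x)) (Term.var (Sum.inr y))

/-- The formula `x = y`. -/
def eq' {n : ℕ} (x y : Fin n) : ZFLang.BoundedFormula Empty n :=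
  Term.bdEqual (Term.var (Sum.inr x)) (Term.var (Sum.inr y))

def extAx : ZFLang.Sentence :=
  ∀' ∀' ((∀' (mem' 2 0 ⇔ mem' 2 1)) ⟹ eq' 0 1)

def pairAx : ZFLang.Sentence :=
  ∀' ∀' ∃' ∀' (mem' 3 2 ⇔ (eq' 3 0 ⊔ eq' 3 1))

def unionAx : ZFLang.Sentence :=
  ∀' ∃' ∀' (mem' 2 1 ⇔ ∃' (mem' 3 0 ⊓ mem' 2 3))

def powerAx : ZFLang.Sentence :=
  ∀' ∃' ∀' (mem' 2 1 ⇔ ∀' (mem' 3 2 ⟹ mem' 3 0))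

def infAx : ZFLang.Sentence :=
  ∃' ((∃' (mem' 1 0 ⊓ ∀' (∼(mem' 2 1)))) ⊓
    (∀' (mem' 1 0 ⟹ ∃' (mem' 2 0 ⊓ ∀' (mem' 3 2 ⇔ (mem' 3 1 ⊔ eq' 3 1))))))

def foundAx : ZFLang.Sentence :=
  ∀' ((∃' (mem' 1 0)) ⟹ ∃' (mem' 1 0 ⊓ ∀' (mem' 2 1 ⟹ ∼(mem' 2 0))))

/-- The separation axiom for a formula with `k` parameters. -/
def sepAx {k : ℕ} (φ : ZFLang.BoundedFormula Empty (k + 1)) : ZFLang.Sentence :=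
  (mem' ⟨k+2, by omega⟩ ⟨k+1, by omega⟩ ⇔
      (mem' ⟨k+2, by omega⟩ ⟨k, by omega⟩ ⊓ φ.liftAt 2 k)).all.ex.all.alls

/-- The collection axiom for a formula with `k` parameters. -/
def collAx {k : ℕ} (φ : ZFLang.BoundedFormula Empty (k + 2)) : ZFLang.Sentence :=
  (mem' ⟨k+2, by omega⟩ ⟨k, by omega⟩ ⟹
      ((φ.liftAt 2 k).ex ⟹
        ((mem' ⟨k+3, by omega⟩ ⟨k+1, by omega⟩ ⊓ φ.liftAt 2 k).ex))).all.ex.all.alls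

def choiceAx : ZFLang.Sentence :=
  (((∀' ((mem' 1 0) ⟹ (∃' (mem' 2 1)))) ⊓
    (∀' ∀' ((((mem' 1 0) ⊓ (mem' 2 0)) ⊓ (∼(eq' 1 2))) ⟹ (∀' (∼((mem' 3 1) ⊓ (mem' 3 2)))))))
   ⟹
   (∃' ∀' ((mem' 2 0) ⟹
      (∃' (((mem' 3 2) ⊓ (mem' 3 1)) ⊓
        (∀' (((mem' 4 2) ⊓ (mem' 4 1)) ⟹ (eq' 4 3)))))))).all

/-- The ZFC axioms: extensionality, pairing, union, powerset, infinity, foundation, choice,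
separation, and collection. -/
def ZFCTheory : ZFLang.Theory :=
  {extAx, pairAx, unionAx, powerAx, infAx, foundAx, choiceAx} ∪
    (⋃ (k : ℕ), Set.range (@sepAx k)) ∪ (⋃ (k : ℕ), Set.range (@collAx k))

/-- A class of ZF-sets is transitive. -/
def SetTransitive (M : Set ZFSet) : Prop := ∀ x ∈ M, ∀ y : ZFSet, y ∈ x → y ∈ M

/-- A transitive model of ZFC. -/
def IsZFCModel (M : Set ZFSet) : Prop := SetTransitive M ∧ ZFCTheory.Model ↥M

/-- Two classes have the same ordinals. -/
def SameOrdinals (M N : Set ZFSet) : Prop :=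
  ∀ x : ZFSet, x.IsOrdinal → (x ∈ M ↔ x ∈ N)

/-- `z` is the pointwise image `j[x]` of `x` under `j`. -/
def ImageSet (M N : Set ZFSet) (j : ↥M → ↥N) (x z : ZFSet) : Prop :=
  ∀ w : ZFSet, w ∈ z ↔ ∃ y : ↥M, (y : ZFSet) ∈ x ∧ ((j y : ↥N) : ZFSet) = w

/-- `j : M → N` is amenable: every pointwise image `j[x]`, `x ∈ M`, belongs to `N`. -/
def Amenable (M N : Set ZFSet) (j : ↥M → ↥N) : Prop :=
  ∀ x ∈ M, ∃ z ∈ N, ImageSet M N j x z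

/-- `κ` is the critical point of `j`: the least ordinal moved. -/
def IsCrit (M N : Set ZFSet) (j : ↥M → ↥N) (κ : ZFSet) : Prop :=
  κ.IsOrdinal ∧ ∃ h : κ ∈ M, ((j ⟨κ, h⟩ : ↥N) : ZFSet) ≠ κ ∧
    ∀ β : ZFSet, β ∈ κ → ∀ hb : β ∈ M, ((j ⟨β, hb⟩ : ↥N) : ZFSet) = β

/-- `f` is a cofinal map from `β` into the ordinal `α`. -/
def CofinalIn (β α f : ZFSet) : Prop :=
  ∀ γ, γ ∈ α → ∃ ξ, ξ ∈ β ∧ ∃ η, ξ.pair η ∈ f ∧ (γ ∈ η ∨ γ = η)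

/-- `α` is a regular ordinal from the point of view of the class `M`. -/
def RegularIn (M : Set ZFSet) (α : ZFSet) : Prop :=
  ∀ β, β ∈ α → ∀ f, f ∈ M → ZFSet.IsFunc β α f → ¬ CofinalIn β α f

/-- `λ` has cofinality `ω` from the point of view of `M`: some function `f ∈ M` maps `ω`
cofinally into `λ`. -/
def CofOmegaIn (M : Set ZFSet) (lam : ZFSet) : Prop :=
  ∃ f ∈ M, ZFSet.IsFunc ZFSet.omega lam f ∧ CofinalIn ZFSet.omega lam f

/-- `μ` is a cardinal from the point of view of `M`: no function of `M` maps a smaller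
ordinal onto it. -/
def CardinalIn (M : Set ZFSet) (μ : ZFSet) : Prop :=
  μ.IsOrdinal ∧ ∀ β, β ∈ μ → ¬ ∃ f ∈ M, ZFSet.IsFunc β μ f ∧
    ∀ γ, γ ∈ μ → ∃ ξ, ξ ∈ β ∧ ξ.pair γ ∈ f

/-- `μ = (λ⁺)^M`, the cardinal successor of `λ` as computed in `M`. -/
def IsCardSuccIn (M : Set ZFSet) (lam μ : ZFSet) : Prop :=
  μ ∈ M ∧ CardinalIn M μ ∧ lam ∈ μ ∧ ∀ ν, ν ∈ μ → lam ∈ ν → ¬ CardinalIn M ν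

namespace ZFModel

universe u

/-- A predicate on assignments which is defined, uniformly in all transitive models of ZFC,
by a formula of set theory. -/
class UDef {n : ℕ} (P : Set ZFSet.{u} → (Fin n → ZFSet.{u}) → Prop) : Prop where
  exists_formula : ∃ φ : ZFLang.BoundedFormula Empty n, ∀ M : Set ZFSet.{u}, IsZFCModel M → ∀ v : Fin n → ↥M,
    φ.Realize default v ↔ P M (fun i => (v i : ZFSet))

theorem realize_mem' {M : Set ZFSet.{u}} {n : ℕ} (x y : Fin n) (e : Empty → ↥M) (v : Fin n → ↥M) :
    (mem' x y).Realize e v ↔ (v x : ZFSet) ∈ (v y : ZFSet) := by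
  rw [mem', BoundedFormula.realize_rel₂]
  rfl

theorem realize_eq' {M : Set ZFSet.{u}} {n : ℕ} (x y : Fin n) (e : Empty → ↥M) (v : Fin n → ↥M) :
    (eq' x y).Realize e v ↔ (v x : ZFSet) = (v y : ZFSet) := by
  rw [eq', BoundedFormula.realize_bdEqual, ← Subtype.ext_iff]
  rfl

namespace UDef

variable {n : ℕ}

instance mem (i k : Fin n) : UDef.{u} (fun _ v => v i ∈ v k) :=
  ⟨⟨mem' i k, fun _ _ _ => realize_mem' ..⟩⟩

instance eq (i k : Fin n) : UDef.{u} (fun _ v => v i = v k) :=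
  ⟨⟨eq' i k, fun _ _ _ => realize_eq' ..⟩⟩

variable {P Q : Set ZFSet.{u} → (Fin n → ZFSet.{u}) → Prop}

instance not [h : UDef P] : UDef (fun M v => ¬ P M v) := by
  obtain ⟨φ, hφ⟩ := h.exists_formula
  exact ⟨⟨∼φ, fun M hM v => by simp [hφ M hM v]⟩⟩

instance and [h : UDef P] [h' : UDef Q] : UDef (fun M v => P M v ∧ Q M v) := by
  obtain ⟨φ, hφ⟩ := h.exists_formula
  obtain ⟨ψ, hψ⟩ := h'.exists_formula
  exact ⟨⟨φ ⊓ ψ, fun M hM v => by simp [hφ M hM v, hψ M hM v]⟩⟩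

instance or [h : UDef P] [h' : UDef Q] : UDef (fun M v => P M v ∨ Q M v) := by
  obtain ⟨φ, hφ⟩ := h.exists_formula
  obtain ⟨ψ, hψ⟩ := h'.exists_formula
  exact ⟨⟨φ ⊔ ψ, fun M hM v => by simp [hφ M hM v, hψ M hM v]⟩⟩

instance imp [h : UDef P] [h' : UDef Q] : UDef (fun M v => P M v → Q M v) := by
  obtain ⟨φ, hφ⟩ := h.exists_formula
  obtain ⟨ψ, hψ⟩ := h'.exists_formula
  exact ⟨⟨φ ⟹ ψ, fun M hM v => by simp [hφ M hM v, hψ M hM v]⟩⟩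

instance iff [h : UDef P] [h' : UDef Q] : UDef (fun M v => P M v ↔ Q M v) := by
  obtain ⟨φ, hφ⟩ := h.exists_formula
  obtain ⟨ψ, hψ⟩ := h'.exists_formula
  exact ⟨⟨φ ⇔ ψ, fun M hM v => by simp [hφ M hM v, hψ M hM v]⟩⟩

theorem congr (h : UDef P)
    (e : ∀ M, IsZFCModel M → ∀ v : Fin n → ZFSet, (∀ i, v i ∈ M) → (Q M v ↔ P M v)) :
    UDef Q := by
  obtain ⟨φ, hφ⟩ := h.exists_formula
  exact ⟨⟨φ, fun M hM v => (hφ M hM v).trans (e M hM _ fun i => (v i).2).symm⟩⟩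

theorem reindex {m : ℕ} {P : Set ZFSet.{u} → (Fin m → ZFSet.{u}) → Prop} (h : UDef P)
    (σ : Fin m → Fin n) : UDef (fun M v => P M (fun i => v (σ i))) := by
  obtain ⟨φ, hφ⟩ := h.exists_formula
  let g : Empty ⊕ Fin m → Empty ⊕ Fin n := Sum.map id σ
  refine ⟨⟨BoundedFormula.relabel (k := 0) g φ.toFormula, fun M hM v => ?_⟩⟩
  have h₁ := BoundedFormula.realize_relabel (M := ↥M) (φ := φ.toFormula) (g := g)
    (v := default) (xs := v)
  have h₂ := BoundedFormula.realize_toFormula (M := ↥M) φ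
    (Sum.elim (default : Empty → ↥M) (v ∘ Fin.castAdd 0) ∘ g)
  rw [Formula.Realize, Subsingleton.elim (default : Fin 0 → ↥M) (v ∘ Fin.natAdd n)] at h₂
  refine h₁.trans (h₂.trans ?_)
  rw [Subsingleton.elim ((Sum.elim default (v ∘ Fin.castAdd 0) ∘ g) ∘ Sum.inl) default]
  exact hφ M hM (fun i => v (σ i))

variable {R : Set ZFSet.{u} → (Fin n → ZFSet.{u}) → ZFSet.{u} → Prop}

instance ex [h : UDef (n := n + 1) (fun M w => R M (fun i => w i.castSucc) (w (Fin.last n)))] :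
    UDef (fun M v => ∃ x, x ∈ M ∧ R M v x) := by
  obtain ⟨φ, hφ⟩ := h.exists_formula
  refine ⟨⟨∃' φ, fun M hM v => ?_⟩⟩
  simp [hφ M hM]

instance all [h : UDef (n := n + 1) (fun M w => R M (fun i => w i.castSucc) (w (Fin.last n)))] :
    UDef (fun M v => ∀ x, x ∈ M → R M v x) := by
  obtain ⟨φ, hφ⟩ := h.exists_formula
  refine ⟨⟨∀' φ, fun M hM v => ?_⟩⟩
  simp [hφ M hM]

instance bex (k : Fin n)
    [h : UDef (n := n + 1) (fun M w => R M (fun i => w i.castSucc) (w (Fin.last n)))] :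
    UDef (fun M v => ∃ x, x ∈ v k ∧ R M v x) :=
  (ex (R := fun M v x => x ∈ v k ∧ R M v x)).congr
    fun _ hM _ hv => ⟨fun ⟨x, hx⟩ => ⟨x, hM.1 _ (hv k) _ hx.1, hx⟩, fun ⟨x, _, hx⟩ => ⟨x, hx⟩⟩

instance ball (k : Fin n)
    [h : UDef (n := n + 1) (fun M w => R M (fun i => w i.castSucc) (w (Fin.last n)))] :
    UDef (fun M v => ∀ x, x ∈ v k → R M v x) :=
  (all (R := fun M v x => x ∈ v k → R M v x)).congr
    fun _ hM _ hv => ⟨fun h x _ hx => h x hx, fun h x hx => h x (hM.1 _ (hv k) _ hx) hx⟩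

end UDef

variable {M : Set ZFSet.{u}}

/-- Separation for uniformly definable predicates with parameters. -/
theorem exists_sep (hM : IsZFCModel M) {k : ℕ}
    {P : Set ZFSet.{u} → (Fin (k + 1) → ZFSet.{u}) → Prop} [hP : UDef P] {a : ZFSet.{u}}
    (ha : a ∈ M) (p : Fin k → ZFSet.{u}) (hp : ∀ i, p i ∈ M) :
    ∃ y ∈ M, ∀ x, x ∈ y ↔ x ∈ a ∧ P M (Matrix.vecCons x p) := by
  obtain ⟨φ, hφ⟩ := (hP.reindex
    (fun i => (Fin.cons (Fin.last k) Fin.castSucc : Fin (k + 1) → Fin (k + 1)) i)).exists_formula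
  have hs : ↥M ⊨ sepAx φ :=
    hM.2.realize_of_mem _ (Or.inl (Or.inr (Set.mem_iUnion.2 ⟨k, φ, rfl⟩)))
  have := BoundedFormula.realize_alls.1 hs (fun i => ⟨p i, hp i⟩)
  simp only [BoundedFormula.realize_all, BoundedFormula.realize_ex, BoundedFormula.realize_iff,
    BoundedFormula.realize_inf, realize_mem',
    BoundedFormula.realize_liftAt (Nat.le_succ k)] at this
  obtain ⟨y, hy⟩ := this ⟨a, ha⟩
  refine ⟨y, y.2, fun x => ?_⟩
  suffices h : ∀ x ∈ M, (x ∈ (y : ZFSet) ↔ x ∈ a ∧ P M (Matrix.vecCons x p)) from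
    ⟨fun hx => (h x (hM.1 _ y.2 _ hx)).1 hx, fun hx => (h x (hM.1 _ ha _ hx.1)).2 hx⟩
  intro x hx
  have key := hy ⟨x, hx⟩
  rw [hφ M hM] at key
  have e₁ : ((⟨k + 2, by omega⟩ : Fin (k + 1 + 1 + 1))) = Fin.last (k + 2) := rfl
  have e₂ : ((⟨k + 1, by omega⟩ : Fin (k + 1 + 1 + 1))) = (Fin.last (k + 1)).castSucc := rfl
  have e₃ : ((⟨k, by omega⟩ : Fin (k + 1 + 1 + 1))) = (Fin.last k).castSucc.castSucc := rfl
  rw [e₁, e₂, e₃] at key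
  simp only [Fin.snoc_last, Fin.snoc_castSucc] at key
  rw [key]
  refine and_congr_right fun _ => iff_of_eq (congrArg _ (funext fun i => ?_))
  induction i using Fin.cases with
  | zero =>
    have : (Fin.last k).addNat 2 = Fin.last (k + 2) := rfl
    simp [this]
  | succ i =>
    have : Fin.castAdd 2 i.castSucc = i.castSucc.castSucc.castSucc := rfl
    simp [this]

end ZFModel

namespace ZFModel

universe u

variable {M : Set ZFSet.{u}}

open ZFSet

namespace UDef

variable {n : ℕ}

instance eq_upair (i k l : Fin n) : UDef.{u} (fun _ v => v i = {v k, v l}) :=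
  (inferInstance : (UDef.{u} (fun _ v => (∀ x, x ∈ v i → x = v k ∨ x = v l) ∧
    v k ∈ v i ∧ v l ∈ v i))).congr fun _ _ v _ => by
      constructor
      · intro h; rw [h]; simp
      · rintro ⟨h₁, h₂, h₃⟩
        ext x
        rw [mem_pair]
        exact ⟨h₁ x, by rintro (rfl | rfl) <;> assumption⟩

instance eq_pair (i k l : Fin n) : UDef.{u} (fun _ v => v i = pair (v k) (v l)) :=
  (inferInstance : (UDef.{u} (fun _ v => ∃ s, s ∈ v i ∧ ∃ t, t ∈ v i ∧ s = {v k, v k} ∧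
    t = {v k, v l} ∧ v i = {s, t}))).congr fun _ _ v _ => by
      simp only [pair_eq_singleton]
      constructor
      · intro h; refine ⟨_, ?_, _, ?_, rfl, rfl, h⟩ <;> rw [h] <;> simp [pair]
      · rintro ⟨_, _, _, _, rfl, rfl, h⟩
        exact h

instance eq_empty (i : Fin n) : UDef.{u} (fun _ v => v i = ∅) :=
  (inferInstance : (UDef.{u} (fun _ v => ∀ x, x ∈ v i → ¬ x = x))).congr fun _ _ v _ => by
    simp [ZFSet.eq_empty]

instance eq_succ (i k : Fin n) : UDef.{u} (fun _ v => v i = insert (v k) (v k)) :=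
  (inferInstance : (UDef.{u} (fun _ v => (∀ x, x ∈ v i → x = v k ∨ x ∈ v k) ∧
    v k ∈ v i ∧ ∀ x, x ∈ v k → x ∈ v i))).congr fun _ _ v _ => by
      constructor
      · intro h; rw [h]; simp +contextual
      · rintro ⟨h₁, h₂, h₃⟩
        ext x
        rw [mem_insert_iff]
        exact ⟨h₁ x, by rintro (rfl | h) <;> [assumption; exact h₃ _ h]⟩

instance subset (i k : Fin n) : UDef.{u} (fun _ v => v i ⊆ v k) :=
  (inferInstance : (UDef.{u} (fun _ v => ∀ x, x ∈ v i → x ∈ v k))).congr fun _ _ _ _ =>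
    ⟨fun h _ hx => h hx, fun h x hx => h x hx⟩

instance isTransitive (i : Fin n) : UDef.{u} (fun _ v => (v i).IsTransitive) :=
  (inferInstance : UDef.{u} (fun _ v => ∀ x, x ∈ v i → x ⊆ v i))

instance isOrdinal (i : Fin n) : UDef.{u} (fun _ v => (v i).IsOrdinal) :=
  (inferInstance : (UDef.{u} (fun _ v => (v i).IsTransitive ∧
    ∀ x, x ∈ v i → x.IsTransitive))).congr fun _ _ _ _ =>
      isOrdinal_iff_forall_mem_isTransitive

end UDef

/-- A term on assignments whose value belongs to, and whose graph is uniformly definable in,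
all transitive models of ZFC. -/
class TDef {n : ℕ} (t : (Fin n → ZFSet.{u}) → ZFSet.{u}) : Prop where
  graph : UDef (n := n + 1) (fun _ w => w (Fin.last n) = t (fun i => w i.castSucc))
  closed : ∀ M, IsZFCModel M → ∀ v : Fin n → ZFSet.{u}, (∀ i, v i ∈ M) → t v ∈ M

theorem UDef.subst {n : ℕ} {R : Set ZFSet.{u} → (Fin n → ZFSet.{u}) → ZFSet.{u} → Prop}
    (t : (Fin n → ZFSet.{u}) → ZFSet.{u}) [ht : TDef t]
    [h : UDef (n := n + 1) (fun M w => R M (fun i => w i.castSucc) (w (Fin.last n)))] :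
    UDef (fun M v => R M v (t v)) :=
  have := ht.graph
  (ex (R := fun M v x => x = t v ∧ R M v x)).congr fun M hM v hv =>
    ⟨fun h => ⟨_, ht.closed M hM v hv, rfl, h⟩, by rintro ⟨_, _, rfl, h⟩; exact h⟩

namespace TDef

variable {n : ℕ}

instance var (i : Fin n) : TDef.{u} (fun v : Fin n → ZFSet => v i) :=
  ⟨inferInstance, fun _ _ _ h => h i⟩

theorem weaken {t : (Fin n → ZFSet.{u}) → ZFSet.{u}} (h : TDef t) :
    TDef (fun v : Fin (n + 1) → ZFSet => t (fun i => v i.castSucc)) := by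
  refine ⟨?_, fun M hM v hv => h.closed M hM _ fun i => hv i.castSucc⟩
  have := h.graph.reindex (Fin.snoc (fun i => i.castSucc.castSucc) (Fin.last (n + 1)) :
    Fin (n + 1) → Fin (n + 2))
  simpa using this

end TDef

namespace UDef

variable {n : ℕ}

/-- Substitution of two terms in a binary predicate. -/
theorem subst₂ {R : ZFSet.{u} → ZFSet.{u} → Prop}
    (hR : UDef (n := n + 2) (fun _ w => R (w (Fin.last n).castSucc) (w (Fin.last (n + 1)))))
    {t s : (Fin n → ZFSet.{u}) → ZFSet.{u}} (ht : TDef t) (hs : TDef s) :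
    UDef (fun _ v => R (t v) (s v)) :=
  have := hs.weaken
  have : UDef (n := n + 1) (fun _ w => R (w (Fin.last n)) (s (fun i => w i.castSucc))) :=
    subst (R := fun _ w x => R (w (Fin.last n)) x) (fun v => s (fun i => v i.castSucc))
  subst (R := fun _ w x => R x (s w)) t

instance mem_term (t s : (Fin n → ZFSet.{u}) → ZFSet.{u}) [ht : TDef t] [hs : TDef s] :
    UDef (fun _ v => t v ∈ s v) :=
  subst₂ (R := (· ∈ ·)) inferInstance ht hs

instance eq_term (t s : (Fin n → ZFSet.{u}) → ZFSet.{u}) [ht : TDef t] [hs : TDef s] :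
    UDef (fun _ v => t v = s v) :=
  subst₂ (R := (· = ·)) inferInstance ht hs

end UDef

section Closure

theorem mem_of_mem (hM : IsZFCModel M) {x y : ZFSet.{u}} (hy : y ∈ M) (hx : x ∈ y) : x ∈ M :=
  hM.1 _ hy _ hx

theorem mem_of_forall_iff (hM : IsZFCModel M) {y z : ZFSet.{u}} (hy : y ∈ M)
    (hz : ∀ x ∈ z, x ∈ M) (h : ∀ x : ↥M, (x : ZFSet) ∈ y ↔ (x : ZFSet) ∈ z) : z ∈ M := by
  have : z = y := by
    ext x
    exact ⟨fun hx => (h ⟨x, hz x hx⟩).2 hx, fun hx => (h ⟨x, mem_of_mem hM hy hx⟩).1 hx⟩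
  exact this ▸ hy

theorem upair_mem (hM : IsZFCModel M) {a b : ZFSet.{u}} (ha : a ∈ M) (hb : b ∈ M) :
    ({a, b} : ZFSet) ∈ M := by
  have h : ↥M ⊨ pairAx := hM.2.realize_of_mem _ (Or.inl (Or.inl (by simp)))
  simp only [pairAx, Sentence.Realize, Formula.Realize, BoundedFormula.realize_all,
    BoundedFormula.realize_ex, BoundedFormula.realize_iff, BoundedFormula.realize_sup,
    realize_mem', realize_eq'] at h
  obtain ⟨y, hy⟩ := h ⟨a, ha⟩ ⟨b, hb⟩
  have hy : ∀ x : ↥M, (x : ZFSet) ∈ (y : ZFSet) ↔ (x : ZFSet) = a ∨ (x : ZFSet) = b := hy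
  refine mem_of_forall_iff hM y.2 (fun x hx => ?_) fun x => (hy x).trans mem_pair.symm
  rcases mem_pair.1 hx with rfl | rfl <;> assumption

theorem sUnion_mem (hM : IsZFCModel M) {a : ZFSet.{u}} (ha : a ∈ M) : (⋃₀ a : ZFSet) ∈ M := by
  have h : ↥M ⊨ unionAx := hM.2.realize_of_mem _ (Or.inl (Or.inl (by simp)))
  simp only [unionAx, Sentence.Realize, Formula.Realize, BoundedFormula.realize_all,
    BoundedFormula.realize_ex, BoundedFormula.realize_iff, BoundedFormula.realize_inf,
    realize_mem'] at h
  obtain ⟨y, hy⟩ := h ⟨a, ha⟩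
  have hy : ∀ x : ↥M, (x : ZFSet) ∈ (y : ZFSet) ↔
    ∃ z : ↥M, (z : ZFSet) ∈ a ∧ (x : ZFSet) ∈ (z : ZFSet) := hy
  refine mem_of_forall_iff hM y.2 (fun x hx => ?_) fun x => ?_
  · obtain ⟨z, hz, hxz⟩ := mem_sUnion.1 hx
    exact mem_of_mem hM (mem_of_mem hM ha hz) hxz
  · rw [hy, mem_sUnion]
    exact ⟨fun ⟨z, hz⟩ => ⟨z, hz⟩, fun ⟨z, hz⟩ => ⟨⟨z, mem_of_mem hM ha hz.1⟩, hz⟩⟩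

theorem exists_powerset (hM : IsZFCModel M) {a : ZFSet.{u}} (ha : a ∈ M) :
    ∃ y ∈ M, ∀ x, x ∈ y ↔ x ∈ M ∧ x ⊆ a := by
  have h : ↥M ⊨ powerAx := hM.2.realize_of_mem _ (Or.inl (Or.inl (by simp)))
  simp only [powerAx, Sentence.Realize, Formula.Realize, BoundedFormula.realize_all,
    BoundedFormula.realize_ex, BoundedFormula.realize_iff, BoundedFormula.realize_imp,
    realize_mem'] at h
  obtain ⟨y, hy⟩ := h ⟨a, ha⟩
  have hy : ∀ x : ↥M, (x : ZFSet) ∈ (y : ZFSet) ↔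
    ∀ z : ↥M, (z : ZFSet) ∈ (x : ZFSet) → (z : ZFSet) ∈ a := hy
  refine ⟨y, y.2, fun x => ⟨fun hx => ?_, fun hx => ?_⟩⟩
  · have hxM := mem_of_mem hM y.2 hx
    exact ⟨hxM, fun z hz => (hy ⟨x, hxM⟩).1 hx ⟨z, mem_of_mem hM hxM hz⟩ hz⟩
  · exact (hy ⟨x, hx.1⟩).2 fun z hz => hx.2 hz

theorem union_mem (hM : IsZFCModel M) {a b : ZFSet.{u}} (ha : a ∈ M) (hb : b ∈ M) :
    a ∪ b ∈ M :=
  sUnion_mem hM (upair_mem hM ha hb)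

theorem singleton_mem (hM : IsZFCModel M) {a : ZFSet.{u}} (ha : a ∈ M) : ({a} : ZFSet) ∈ M :=
  pair_eq_singleton a ▸ upair_mem hM ha ha

theorem pair_mem (hM : IsZFCModel M) {a b : ZFSet.{u}} (ha : a ∈ M) (hb : b ∈ M) :
    pair a b ∈ M :=
  upair_mem hM (singleton_mem hM ha) (upair_mem hM ha hb)

theorem insert_mem (hM : IsZFCModel M) {a b : ZFSet.{u}} (ha : a ∈ M) (hb : b ∈ M) :
    insert a b ∈ M := by
  have : insert a b = {a} ∪ b := by ext; simp
  exact this ▸ union_mem hM (singleton_mem hM ha) hb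

theorem right_mem_of_pair_mem (hM : IsZFCModel M) {a b : ZFSet.{u}} (h : pair a b ∈ M) : b ∈ M :=
  mem_of_mem hM (mem_of_mem hM h (show {a, b} ∈ pair a b by simp [pair])) (by simp)

theorem exists_mem_infinite (hM : IsZFCModel M) :
    ∃ x ∈ M, ∅ ∈ x ∧ ∀ y ∈ x, insert y y ∈ x := by
  have h : ↥M ⊨ infAx := hM.2.realize_of_mem _ (Or.inl (Or.inl (by simp)))
  simp only [infAx, Sentence.Realize, Formula.Realize, BoundedFormula.realize_all,
    BoundedFormula.realize_ex, BoundedFormula.realize_iff, BoundedFormula.realize_imp,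
    BoundedFormula.realize_inf, BoundedFormula.realize_sup, BoundedFormula.realize_not,
    realize_mem', realize_eq'] at h
  obtain ⟨x, ⟨e, he, he'⟩, hx⟩ := h
  have he : (e : ZFSet) ∈ (x : ZFSet) := he
  have he' : ∀ z : ↥M, (z : ZFSet) ∉ (e : ZFSet) := he'
  have hx : ∀ y : ↥M, (y : ZFSet) ∈ (x : ZFSet) → ∃ s : ↥M, (s : ZFSet) ∈ (x : ZFSet) ∧
    ∀ z : ↥M, (z : ZFSet) ∈ (s : ZFSet) ↔ (z : ZFSet) ∈ (y : ZFSet) ∨ (z : ZFSet) = y := hx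
  have e0 : (e : ZFSet) = ∅ := (eq_empty _).2 fun z hz => he' ⟨z, mem_of_mem hM e.2 hz⟩ hz
  refine ⟨x, x.2, e0 ▸ he, fun y hy => ?_⟩
  have hyM := mem_of_mem hM x.2 hy
  obtain ⟨s, hs, h⟩ := hx ⟨y, hyM⟩ hy
  have : insert y y = (s : ZFSet) := by
    ext z
    rw [mem_insert_iff, or_comm]
    refine ⟨fun hz => ?_, fun hz => (h ⟨z, mem_of_mem hM s.2 hz⟩).1 hz⟩
    have hzM : z ∈ M := by
      rcases hz with hz | rfl
      exacts [mem_of_mem hM hyM hz, hyM]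
    exact (h ⟨z, hzM⟩).2 hz
  exact this ▸ hs

theorem empty_mem (hM : IsZFCModel M) : (∅ : ZFSet) ∈ M :=
  let ⟨_, hx, h, _⟩ := exists_mem_infinite hM
  mem_of_mem hM hx h

end Closure

namespace TDef

variable {n : ℕ} (t s : (Fin n → ZFSet.{u}) → ZFSet.{u})

instance empty : TDef.{u} (fun _ : Fin n → ZFSet => ∅) :=
  ⟨inferInstance, fun _ hM _ _ => empty_mem hM⟩

instance pair_term [ht : TDef t] [hs : TDef s] : TDef (fun v => pair (t v) (s v)) :=
  have := ht.weaken
  have := hs.weaken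
  ⟨UDef.subst (R := fun _ w x => w (Fin.last n) = pair x (s fun i => w i.castSucc))
    (h := have := hs.weaken.weaken
      UDef.subst (R := fun _ w x => w (Fin.last n).castSucc = pair (w (Fin.last (n + 1))) x)
      (fun w => s fun i => w i.castSucc.castSucc)) (fun w => t fun i => w i.castSucc),
    fun _ hM v hv => pair_mem hM (ht.closed _ hM v hv) (hs.closed _ hM v hv)⟩

instance succ_term [ht : TDef t] : TDef (fun v => insert (t v) (t v)) :=
  have := ht.weaken
  ⟨UDef.subst (R := fun _ w x => w (Fin.last n) = insert x x) (fun w => t fun i => w i.castSucc),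
    fun _ hM v hv => insert_mem hM (ht.closed _ hM v hv) (ht.closed _ hM v hv)⟩

end TDef

end ZFModel

namespace ZFModel

universe u

variable {M : Set ZFSet.{u}}

open ZFSet

/-- Knaster–Tarski inside a transitive model: a definable monotone operator on the subsets of `a`
has a fixed point in the model. -/
theorem exists_fixedPoint (hM : IsZFCModel M) {k : ℕ}
    (P : Set ZFSet.{u} → (Fin (k + 2) → ZFSet.{u}) → Prop) [hP : UDef P] {a : ZFSet.{u}}
    (ha : a ∈ M) (p : Fin k → ZFSet.{u}) (hp : ∀ i, p i ∈ M)
    (mono : ∀ x ∈ a, ∀ F G : ZFSet.{u}, F ⊆ G → P M (Matrix.vecCons x (Matrix.vecCons F p)) →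
      P M (Matrix.vecCons x (Matrix.vecCons G p))) :
    ∃ F ∈ M, ∀ x, x ∈ F ↔ x ∈ a ∧ P M (Matrix.vecCons x (Matrix.vecCons F p)) := by
  have hQ : UDef (n := k + 2) (fun M w => ∀ Y, Y ∈ M → (∀ z, z ∈ w 1 →
      P M (Matrix.vecCons z (Matrix.vecCons Y fun i => w i.succ.succ)) → z ∈ Y) → w 0 ∈ Y) := by
    have := hP.reindex (n := k + 4) (Matrix.vecCons (Fin.last (k + 3))
      (Matrix.vecCons (Fin.last (k + 2)).castSucc fun i => i.succ.succ.castSucc.castSucc))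
    have h' : UDef (n := k + 4) (fun M w => P M (Matrix.vecCons (w (Fin.last (k + 3)))
      (Matrix.vecCons (w (Fin.last (k + 2)).castSucc)
        fun i => w i.succ.succ.castSucc.castSucc))) := by
      refine this.congr fun M _ v _ => ?_
      have : (fun i => v (Matrix.vecCons (Fin.last (k + 3))
        (Matrix.vecCons (Fin.last (k + 2)).castSucc fun i => i.succ.succ.castSucc.castSucc) i)) =
          Matrix.vecCons (v (Fin.last (k + 3))) (Matrix.vecCons (v (Fin.last (k + 2)).castSucc)
            fun i => v i.succ.succ.castSucc.castSucc) := by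
        funext i
        refine Fin.cases rfl (fun i => ?_) i
        refine Fin.cases rfl (fun i => rfl) i
      rw [this]
    infer_instance
  obtain ⟨F, hF, h⟩ := exists_sep hM (hP := hQ) ha (Matrix.vecCons a p)
    (Fin.cases ha hp)
  have h : ∀ x, x ∈ F ↔ x ∈ a ∧ ∀ Y, Y ∈ M → (∀ z, z ∈ a →
    P M (Matrix.vecCons z (Matrix.vecCons Y p)) → z ∈ Y) → x ∈ Y := h
  have key : ∀ x ∈ a, P M (Matrix.vecCons x (Matrix.vecCons F p)) → x ∈ F := fun x hx hPx =>
    (h x).2 ⟨hx, fun Y hY hc => hc x hx (mono x hx F Y (fun y hy => ((h y).1 hy).2 Y hY hc) hPx)⟩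
  obtain ⟨G, hG, hGF⟩ := exists_sep hM (k := k + 1) (hP := hP) ha (Matrix.vecCons F p)
    (Fin.cases hF hp)
  refine ⟨F, hF, fun x => ⟨fun hx => ⟨((h x).1 hx).1, ?_⟩, fun hx => key x hx.1 hx.2⟩⟩
  refine ((hGF x).1 (((h x).1 hx).2 G hG fun z hz hPz => (hGF z).2 ⟨hz, ?_⟩)).2
  exact mono z hz G F (fun y hy => key y ((hGF y).1 hy).1 ((hGF y).1 hy).2) hPz

theorem prod_mem (hM : IsZFCModel M) {a b : ZFSet.{u}} (ha : a ∈ M) (hb : b ∈ M) :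
    prod a b ∈ M := by
  obtain ⟨p, hp, hp'⟩ := exists_powerset hM (union_mem hM ha hb)
  obtain ⟨q, hq, hq'⟩ := exists_powerset hM hp
  obtain ⟨y, hy, h⟩ := exists_sep hM (k := 2)
    (P := fun _ v => ∃ x, x ∈ v 1 ∧ ∃ z, z ∈ v 2 ∧ v 0 = pair x z) hq ![a, b]
    (by simp [Fin.forall_fin_two, ha, hb])
  have h : ∀ x, x ∈ y ↔ x ∈ q ∧ ∃ u, u ∈ a ∧ ∃ v, v ∈ b ∧ x = pair u v := h
  have : prod a b = y := by
    ext x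
    rw [h, mem_prod]
    refine ⟨?_, fun h => h.2⟩
    rintro ⟨s, hs, t, ht, rfl⟩
    have hsM := mem_of_mem hM ha hs
    have htM := mem_of_mem hM hb ht
    refine ⟨(hq' _).2 ⟨pair_mem hM hsM htM, fun w hw => (hp' w).2 ?_⟩, s, hs, t, ht, rfl⟩
    rw [pair, mem_pair] at hw
    rcases hw with rfl | rfl
    · exact ⟨singleton_mem hM hsM, fun w hw => by simp at hw; simp [hw, hs]⟩
    · exact ⟨upair_mem hM hsM htM, fun w hw => by simp at hw; rcases hw with rfl | rfl <;> simp [hs, ht]⟩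
  exact this ▸ hy

section Omega

theorem mem_omega_iff {x : ZFSet.{u}} :
    x ∈ omega.{u} ↔ x = ∅ ∨ ∃ y ∈ omega.{u}, x = insert y y := by
  constructor
  · refine Quotient.inductionOn x fun x hx => ?_
    obtain ⟨⟨n⟩, hn⟩ := hx
    have : (⟦x⟧ : ZFSet) = mk (PSet.ofNat n) := Quotient.sound hn
    rw [this]
    cases n with
    | zero => exact Or.inl rfl
    | succ n => exact Or.inr ⟨mk (PSet.ofNat n), ⟨⟨n⟩, PSet.Equiv.refl _⟩, rfl⟩
  · rintro (rfl | ⟨y, hy, rfl⟩)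
    exacts [omega_zero, omega_succ hy]

theorem eq_omega_iff {x : ZFSet.{u}} :
    x = omega ↔ ∀ y, y ∈ x ↔ y = ∅ ∨ ∃ z ∈ x, y = insert z z := by
  constructor
  · rintro rfl y; exact mem_omega_iff
  · intro h
    ext y
    induction y using inductionOn with
    | _ y ih =>
      rw [h, mem_omega_iff]
      refine or_congr_right ⟨?_, ?_⟩ <;> rintro ⟨z, hz, rfl⟩
      · exact ⟨z, (ih z (by simp)).1 hz, rfl⟩
      · exact ⟨z, (ih z (by simp)).2 hz, rfl⟩

theorem omega_induction {p : ZFSet.{u} → Prop} (h0 : p ∅)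
    (hs : ∀ n ∈ omega.{u}, p n → p (insert n n)) : ∀ n ∈ omega.{u}, p n := by
  intro n
  induction n using inductionOn with
  | _ n ih =>
    intro hn
    rcases mem_omega_iff.1 hn with rfl | ⟨m, hm, rfl⟩
    exacts [h0, hs m hm (ih m (by simp) hm)]

theorem isOrdinal_of_mem_omega {n : ZFSet.{u}} (hn : n ∈ omega.{u}) : n.IsOrdinal := by
  refine omega_induction isOrdinal_empty (fun n _ h => ?_) n hn
  exact isOrdinal_succ h

theorem isOrdinal_omega : omega.{u}.IsOrdinal := by
  refine isOrdinal_iff_forall_mem_isOrdinal.2 ⟨?_, fun x hx => isOrdinal_of_mem_omega hx⟩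
  intro n hn
  refine omega_induction (p := fun n => n ⊆ omega) (fun x hx => by simp at hx) (fun n hn h x hx => ?_) n hn
  rcases mem_insert_iff.1 hx with rfl | hx
  exacts [hn, h hx]

theorem omega_mem (hM : IsZFCModel M) : omega.{u} ∈ M := by
  obtain ⟨a, ha, h0, hs⟩ := exists_mem_infinite hM
  obtain ⟨F, hF, h⟩ := exists_fixedPoint hM (k := 0)
    (fun _ v => v 0 = ∅ ∨ ∃ y, y ∈ v 1 ∧ v 0 = insert y y) ha ![] (fun i => i.elim0)
    (by
      rintro x - F G hFG (h | ⟨y, hy, h⟩)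
      exacts [Or.inl h, Or.inr ⟨y, hFG hy, h⟩])
  have h : ∀ x, x ∈ F ↔ x ∈ a ∧ (x = ∅ ∨ ∃ y, y ∈ F ∧ x = insert y y) := h
  have : F = omega := by
    refine eq_omega_iff.2 fun y => (h y).trans ⟨fun h => h.2, fun hy => ⟨?_, hy⟩⟩
    rcases hy with rfl | ⟨z, hz, rfl⟩
    exacts [h0, hs _ ((h z).1 hz).1]
  exact this ▸ hF

instance UDef.eq_omega {n : ℕ} (i : Fin n) : UDef.{u} (fun _ v => v i = omega) :=
  (inferInstance : UDef.{u} (fun M v => ∀ y, y ∈ M → (y ∈ v i ↔ y = ∅ ∨ ∃ z, z ∈ v i ∧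
    y = insert z z))).congr fun M hM v hv => by
      rw [eq_omega_iff]
      refine ⟨fun h y _ => h y, fun h y => ?_⟩
      refine ⟨fun hy => (h y (mem_of_mem hM (hv i) hy)).1 hy, fun hy => (h y ?_).2 hy⟩
      rcases hy with rfl | ⟨z, hz, rfl⟩
      · exact empty_mem hM
      · have := mem_of_mem hM (hv i) hz
        exact insert_mem hM this this

end Omega

end ZFModel

namespace ZFModel

universe u

variable {M N : Set ZFSet.{u}}

open ZFSet

theorem isFunc_iff {x y f : ZFSet.{u}} : IsFunc x y f ↔
    (∀ e, e ∈ f → ∃ a, a ∈ x ∧ ∃ b, b ∈ y ∧ e = pair a b) ∧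
    ∀ z, z ∈ x → ∃ w, w ∈ y ∧ pair z w ∈ f ∧ ∀ w', w' ∈ y → pair z w' ∈ f → w' = w := by
  constructor
  · rintro ⟨h₁, h₂⟩
    refine ⟨fun e he => by simpa using mem_prod.1 (h₁ he), fun z hz => ?_⟩
    obtain ⟨w, hw, hu⟩ := h₂ z hz
    exact ⟨w, (pair_mem_prod.1 (h₁ hw)).2, hw, fun w' _ h => hu w' h⟩
  · rintro ⟨h₁, h₂⟩
    have hs : f ⊆ prod x y := fun e he => mem_prod.2 (by simpa using h₁ e he)
    refine ⟨hs, fun z hz => ?_⟩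
    obtain ⟨w, hw, hzw, hu⟩ := h₂ z hz
    exact ⟨w, hzw, fun w' h => hu w' (pair_mem_prod.1 (hs h)).2 h⟩

namespace UDef

variable {n : ℕ}

instance isFunc (i k l : Fin n) : UDef.{u} (fun _ v => IsFunc (v i) (v k) (v l)) :=
  (inferInstance : UDef.{u} (fun _ v => (∀ e, e ∈ v l → ∃ a, a ∈ v i ∧ ∃ b, b ∈ v k ∧
    e = pair a b) ∧ ∀ z, z ∈ v i → ∃ w, w ∈ v k ∧ pair z w ∈ v l ∧ ∀ w', w' ∈ v k →
      pair z w' ∈ v l → w' = w)).congr fun _ _ _ _ => isFunc_iff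

instance cofinalIn (i k l : Fin n) : UDef.{u} (fun _ v => CofinalIn (v i) (v k) (v l)) :=
  (inferInstance : UDef.{u} (fun M v => ∀ γ, γ ∈ v k → ∃ ξ, ξ ∈ v i ∧ ∃ η, η ∈ M ∧
    (pair ξ η ∈ v l ∧ (γ ∈ η ∨ γ = η)))).congr fun _ hM _ hv =>
      forall₂_congr fun _ _ => exists_congr fun _ => and_congr_right fun _ =>
        exists_congr fun _ => ⟨fun h => ⟨right_mem_of_pair_mem hM (mem_of_mem hM (hv l) h.1), h⟩,
          fun h => h.2⟩

instance cardinalIn (i : Fin n) : UDef.{u} (fun M v => CardinalIn M (v i)) :=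
  (inferInstance : UDef.{u} (fun M v => (v i).IsOrdinal ∧ ∀ β, β ∈ v i → ¬ ∃ f, f ∈ M ∧
    (IsFunc β (v i) f ∧ ∀ γ, γ ∈ v i → ∃ ξ, ξ ∈ β ∧ pair ξ γ ∈ f)))

instance isCardSuccIn (i k : Fin n) : UDef.{u} (fun M v => IsCardSuccIn M (v i) (v k)) :=
  (inferInstance : UDef.{u} (fun M v => CardinalIn M (v k) ∧ v i ∈ v k ∧
    ∀ ν, ν ∈ v k → v i ∈ ν → ¬ CardinalIn M ν)).congr fun _ _ _ hv =>
      ⟨fun h => h.2, fun h => ⟨hv k, h⟩⟩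

end UDef

/-- `J` restricts to an elementary map from `M` to `N`, in the sense of uniformly definable
predicates. -/
structure Elem (M N : Set ZFSet.{u}) (J : ZFSet.{u} → ZFSet.{u}) : Prop where
  left : IsZFCModel M
  right : IsZFCModel N
  maps : ∀ x ∈ M, J x ∈ N
  iff : ∀ {n : ℕ} (P : Set ZFSet.{u} → (Fin n → ZFSet.{u}) → Prop) [UDef P] (v : Fin n → ZFSet.{u}),
    (∀ i, v i ∈ M) → (P N (fun i => J (v i)) ↔ P M v)

theorem elem_of_elementaryEmbedding (hM : IsZFCModel M) (hN : IsZFCModel N)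
    (j : ↥M ↪ₑ[ZFLang] ↥N) {J : ZFSet.{u} → ZFSet.{u}} (h : ∀ x : ↥M, J x = j x) : Elem M N J where
  left := hM
  right := hN
  maps x hx := h ⟨x, hx⟩ ▸ (j ⟨x, hx⟩).2
  iff P hP v hv := by
    obtain ⟨φ, hφ⟩ := hP.exists_formula
    have := j.map_boundedFormula φ default (fun i => ⟨v i, hv i⟩)
    rw [hφ M hM, Subsingleton.elim (⇑j ∘ default) default, hφ N hN] at this
    rw [← this]
    refine iff_of_eq (congrArg (P N) (funext fun i => h ⟨v i, hv i⟩))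

theorem forall_vec₂ {x y : ZFSet.{u}} (hx : x ∈ M) (hy : y ∈ M) : ∀ i, ![x, y] i ∈ M := by
  simp [Fin.forall_fin_succ, hx, hy]

theorem forall_vec₃ {x y z : ZFSet.{u}} (hx : x ∈ M) (hy : y ∈ M) (hz : z ∈ M) :
    ∀ i, ![x, y, z] i ∈ M := by
  simp [Fin.forall_fin_succ, hx, hy, hz]

theorem forall_vec₄ {x y z w : ZFSet.{u}} (hx : x ∈ M) (hy : y ∈ M) (hz : z ∈ M) (hw : w ∈ M) :
    ∀ i, ![x, y, z, w] i ∈ M := by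
  simp [Fin.forall_fin_succ, hx, hy, hz, hw]

namespace Elem

variable {J : ZFSet.{u} → ZFSet.{u}} {x y z : ZFSet.{u}}

theorem mem_iff (hJ : Elem M N J) (hx : x ∈ M) (hy : y ∈ M) : J x ∈ J y ↔ x ∈ y :=
  hJ.iff (fun _ v => v 0 ∈ v 1) ![x, y] (forall_vec₂ hx hy)

theorem eq_iff (hJ : Elem M N J) (hx : x ∈ M) (hy : y ∈ M) : J x = J y ↔ x = y :=
  hJ.iff (fun _ v => v 0 = v 1) ![x, y] (forall_vec₂ hx hy)

theorem isOrdinal_iff (hJ : Elem M N J) (hx : x ∈ M) : (J x).IsOrdinal ↔ x.IsOrdinal :=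
  hJ.iff (fun _ v => (v 0).IsOrdinal) ![x, x] (forall_vec₂ hx hx)

theorem map_pair (hJ : Elem M N J) (hx : x ∈ M) (hy : y ∈ M) : J (pair x y) = pair (J x) (J y) :=
  (hJ.iff (n := 3) (fun _ v => v 2 = pair (v 0) (v 1)) ![x, y, pair x y]
    (forall_vec₃ hx hy (pair_mem hJ.left hx hy))).2 rfl

theorem map_succ (hJ : Elem M N J) (hx : x ∈ M) : J (insert x x) = insert (J x) (J x) :=
  (hJ.iff (n := 2) (fun _ v => v 1 = insert (v 0) (v 0)) ![x, insert x x]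
    (forall_vec₂ hx (insert_mem hJ.left hx hx))).2 rfl

theorem map_empty (hJ : Elem M N J) : J ∅ = ∅ :=
  have h := empty_mem hJ.left
  (hJ.iff (n := 2) (fun _ v => v 1 = ∅) ![∅, ∅] (forall_vec₂ h h)).2 rfl

theorem map_omega (hJ : Elem M N J) : J omega = omega :=
  have h := omega_mem hJ.left
  (hJ.iff (n := 2) (fun _ v => v 1 = omega) ![omega, omega] (forall_vec₂ h h)).2 rfl

theorem map_of_mem_omega (hJ : Elem M N J) (hx : x ∈ omega) : J x = x := by
  refine omega_induction (p := fun n => J n = n) hJ.map_empty (fun n hn h => ?_) x hx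
  rw [hJ.map_succ (mem_of_mem hJ.left (omega_mem hJ.left) hn), h]

theorem isFunc_iff (hJ : Elem M N J) (hx : x ∈ M) (hy : y ∈ M) (hz : z ∈ M) :
    IsFunc (J x) (J y) (J z) ↔ IsFunc x y z :=
  hJ.iff (fun _ v => IsFunc (v 0) (v 1) (v 2)) ![x, y, z] (forall_vec₃ hx hy hz)

theorem cofinalIn_iff (hJ : Elem M N J) (hx : x ∈ M) (hy : y ∈ M) (hz : z ∈ M) :
    CofinalIn (J x) (J y) (J z) ↔ CofinalIn x y z :=
  hJ.iff (fun _ v => CofinalIn (v 0) (v 1) (v 2)) ![x, y, z] (forall_vec₃ hx hy hz)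

theorem isCardSuccIn_iff (hJ : Elem M N J) (hx : x ∈ M) (hy : y ∈ M) :
    IsCardSuccIn N (J x) (J y) ↔ IsCardSuccIn M x y :=
  hJ.iff (fun M v => IsCardSuccIn M (v 0) (v 1)) ![x, y] (forall_vec₂ hx hy)

theorem notMem_self (hJ : Elem M N J) : x.IsOrdinal → x ∈ M → J x ∉ x := by
  induction x using inductionOn with
  | _ x ih =>
    intro ho hx h
    exact ih _ h (ho.mem h) (mem_of_mem hJ.left hx h)
      ((hJ.mem_iff (mem_of_mem hJ.left hx h) hx).2 h)

/-- If `x` is transitive and `J[x] ∈ N`, then the restriction of `J` to `x` belongs to `N`. -/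
theorem exists_restrict (hJ : Elem M N J) (hx : x ∈ M) (hxt : x.IsTransitive) (hxN : x ∈ N)
    (hz : z ∈ N) (hzx : ∀ w, w ∈ z ↔ ∃ y ∈ x, J y = w) :
    ∃ F ∈ N, ∀ p, p ∈ F ↔ ∃ y ∈ x, p = pair y (J y) := by
  obtain ⟨F, hF, h⟩ := exists_fixedPoint hJ.right (k := 2)
    (fun N v => ∃ b, b ∈ v 2 ∧ ∃ w, w ∈ v 3 ∧ v 0 = pair b w ∧
      (∀ y, y ∈ v 3 → y ∈ w → ∃ g, g ∈ b ∧ pair g y ∈ v 1) ∧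
      (∀ g, g ∈ b → ∃ y, y ∈ v 3 ∧ y ∈ w ∧ pair g y ∈ v 1))
    (prod_mem hJ.right hxN hz) ![x, z] (forall_vec₂ hxN hz)
    (by
      rintro p - F G hFG ⟨b, hb, w, hw, hp, h₁, h₂⟩
      refine ⟨b, hb, w, hw, hp, fun y hy hyw => ?_, fun g hg => ?_⟩
      · obtain ⟨g, hg, h⟩ := h₁ y hy hyw
        exact ⟨g, hg, hFG h⟩
      · obtain ⟨y, hy, hyw, h⟩ := h₂ g hg
        exact ⟨y, hy, hyw, hFG h⟩)
  have h : ∀ p, p ∈ F ↔ p ∈ prod x z ∧ ∃ b, b ∈ x ∧ ∃ w, w ∈ z ∧ p = pair b w ∧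
      (∀ y, y ∈ z → y ∈ w → ∃ g, g ∈ b ∧ pair g y ∈ F) ∧
      (∀ g, g ∈ b → ∃ y, y ∈ z ∧ y ∈ w ∧ pair g y ∈ F) := h
  have hM : ∀ {y}, y ∈ x → y ∈ M := fun hy => mem_of_mem hJ.left hx hy
  have key : ∀ b, b ∈ x → ∀ w, pair b w ∈ F ↔ w = J b := by
    intro b
    induction b using inductionOn with
    | _ b ih =>
      intro hb w
      have ih' : ∀ g ∈ b, ∀ w, pair g w ∈ F ↔ w = J g := fun g hg => ih g hg (hxt.mem_trans hg hb)
      constructor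
      · intro hp
        obtain ⟨-, b', -, w', hw, he, h₁, h₂⟩ := (h _).1 hp
        obtain ⟨rfl, rfl⟩ := pair_inj.1 he
        obtain ⟨b', hb', rfl⟩ := (hzx w).1 hw
        have : b' = b := by
          ext g
          constructor
          · intro hg
            obtain ⟨g', hg', hF⟩ := h₁ (J g) ((hzx _).2 ⟨g, hxt.mem_trans hg hb', rfl⟩)
              ((hJ.mem_iff (hM (hxt.mem_trans hg hb')) (hM hb')).2 hg)
            rw [ih' g' hg', hJ.eq_iff (hM (hxt.mem_trans hg hb')) (hM (hxt.mem_trans hg' hb))] at hF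
            exact hF ▸ hg'
          · intro hg
            obtain ⟨y, hy, hyw, hF⟩ := h₂ g hg
            rw [ih' g hg] at hF
            subst hF
            exact (hJ.mem_iff (hM (hxt.mem_trans hg hb)) (hM hb')).1 hyw
        rw [this]
      · rintro rfl
        have hz' : ∀ {y}, y ∈ x → J y ∈ z := fun hy => (hzx _).2 ⟨_, hy, rfl⟩
        refine (h _).2 ⟨pair_mem_prod.2 ⟨hb, hz' hb⟩, b, hb, _, hz' hb, rfl, fun y hy hyb => ?_,
          fun g hg => ⟨J g, hz' (hxt.mem_trans hg hb), ?_, (ih' g hg _).2 rfl⟩⟩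
        · obtain ⟨g, hg, rfl⟩ := (hzx y).1 hy
          have := (hJ.mem_iff (hM hg) (hM hb)).1 hyb
          exact ⟨g, this, (ih' g this _).2 rfl⟩
        · exact (hJ.mem_iff (hM (hxt.mem_trans hg hb)) (hM hb)).2 hg
  refine ⟨F, hF, fun p => ⟨fun hp => ?_, ?_⟩⟩
  · obtain ⟨-, b, hb, w, hw, rfl, -⟩ := (h p).1 hp
    exact ⟨b, hb, by rw [(key b hb w).1 hp]⟩
  · rintro ⟨b, hb, rfl⟩
    exact (key b hb _).2 rfl

/-- A binary relation of `M` on `x` belongs to `N` if the restriction of `J` to `x` does. -/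
theorem rel_mem (hJ : Elem M N J) (hx : x ∈ M) (hxN : x ∈ N) {F : ZFSet.{u}} (hF : F ∈ N)
    (hFx : ∀ p, p ∈ F ↔ ∃ y ∈ x, p = pair y (J y)) {f : ZFSet.{u}} (hf : f ∈ M)
    (hfx : f ⊆ prod x x) : f ∈ N := by
  obtain ⟨g, hg, h⟩ := exists_sep hJ.right (k := 3)
    (P := fun N v => ∃ a, a ∈ v 1 ∧ ∃ b, b ∈ v 1 ∧ v 0 = pair a b ∧ ∃ a', a' ∈ N ∧ ∃ b', b' ∈ N ∧
      pair a a' ∈ v 2 ∧ pair b b' ∈ v 2 ∧ pair a' b' ∈ v 3)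
    (prod_mem hJ.right hxN hxN) ![x, F, J f] (forall_vec₃ hxN hF (hJ.maps f hf))
  have h : ∀ p, p ∈ g ↔ p ∈ prod x x ∧ ∃ a, a ∈ x ∧ ∃ b, b ∈ x ∧ p = pair a b ∧ ∃ a', a' ∈ N ∧
    ∃ b', b' ∈ N ∧ pair a a' ∈ F ∧ pair b b' ∈ F ∧ pair a' b' ∈ J f := h
  have hM : ∀ {y}, y ∈ x → y ∈ M := fun hy => mem_of_mem hJ.left hx hy
  have hF' : ∀ a b, pair a b ∈ F ↔ a ∈ x ∧ b = J a := fun a b => by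
    rw [hFx]
    constructor
    · rintro ⟨y, hy, he⟩
      obtain ⟨rfl, rfl⟩ := pair_inj.1 he
      exact ⟨hy, rfl⟩
    · rintro ⟨ha, rfl⟩
      exact ⟨a, ha, rfl⟩
  have : f = g := by
    ext p
    rw [h]
    constructor
    · intro hp
      have hp' := hfx hp
      obtain ⟨a, ha, b, hb, rfl⟩ := mem_prod.1 hp'
      refine ⟨hp', a, ha, b, hb, rfl, J a, hJ.maps _ (hM ha), J b, hJ.maps _ (hM hb),
        (hF' _ _).2 ⟨ha, rfl⟩, (hF' _ _).2 ⟨hb, rfl⟩, ?_⟩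
      rw [← hJ.map_pair (hM ha) (hM hb)]
      exact (hJ.mem_iff (pair_mem hJ.left (hM ha) (hM hb)) hf).2 hp
    · rintro ⟨-, a, ha, b, hb, rfl, a', -, b', -, h₁, h₂, h₃⟩
      obtain ⟨-, rfl⟩ := (hF' _ _).1 h₁
      obtain ⟨-, rfl⟩ := (hF' _ _).1 h₂
      rw [← hJ.map_pair (hM ha) (hM hb)] at h₃
      exact (hJ.mem_iff (pair_mem hJ.left (hM ha) (hM hb)) hf).1 h₃
  exact this ▸ hg

end Elem

end ZFModel

namespace ZFModel

universe u

variable {M N : Set ZFSet.{u}}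

open ZFSet

theorem succ_inj {a b : ZFSet.{u}} (h : insert a a = insert b b) : a = b := by
  have h₁ : a ∈ insert b b := h ▸ mem_insert a a
  have h₂ : b ∈ insert a a := h.symm ▸ mem_insert b b
  rcases mem_insert_iff.1 h₁ with h₁ | h₁
  · exact h₁
  rcases mem_insert_iff.1 h₂ with h₂ | h₂
  · exact h₂.symm
  · exact absurd h₁ (mem_asymm h₂)

theorem succ_ne_empty (a : ZFSet.{u}) : insert a a ≠ ∅ := fun h => by
  have := mem_insert a a
  rw [h] at this
  exact notMem_empty _ this

/-- The von Neumann numerals. -/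
noncomputable def numeral : ℕ → ZFSet.{u}
  | 0 => ∅
  | n + 1 => insert (numeral n) (numeral n)

theorem mem_omega_iff_numeral {x : ZFSet.{u}} : x ∈ omega.{u} ↔ ∃ n, x = numeral n := by
  constructor
  · refine omega_induction (p := fun x => ∃ n, x = numeral n) ⟨0, rfl⟩ ?_ x
    rintro _ - ⟨n, rfl⟩
    exact ⟨n + 1, rfl⟩
  · rintro ⟨n, rfl⟩
    induction n with
    | zero => exact omega_zero
    | succ n ih => exact omega_succ ih

/-- A sequence of elements of `x` given by iterating a function of `N` belongs to `N`. -/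
theorem exists_iterate (hN : IsZFCModel N) {x F : ZFSet.{u}} (hx : x ∈ N) (hF : F ∈ N)
    {c : ℕ → ZFSet.{u}} (hc : ∀ n, c n ∈ x) (hFc : ∀ n y, pair (c n) y ∈ F ↔ y = c (n + 1)) :
    ∃ s ∈ N, IsFunc omega x s ∧ ∀ n y, pair (numeral n) y ∈ s ↔ y = c n := by
  obtain ⟨s, hs, h⟩ := exists_fixedPoint hN (k := 2)
    (fun N v => v 0 = pair ∅ (v 2) ∨ ∃ q, q ∈ v 1 ∧ ∃ n, n ∈ N ∧ ∃ a, a ∈ N ∧ ∃ b, b ∈ N ∧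
      q = pair n a ∧ v 0 = pair (insert n n) b ∧ pair a b ∈ v 3)
    (prod_mem hN (omega_mem hN) hx) ![c 0, F] (forall_vec₂ (mem_of_mem hN hx (hc 0)) hF)
    (by
      rintro p - F G hFG (h | ⟨q, hq, h⟩)
      exacts [Or.inl h, Or.inr ⟨q, hFG hq, h⟩])
  have h : ∀ p, p ∈ s ↔ p ∈ prod omega x ∧ (p = pair ∅ (c 0) ∨ ∃ q, q ∈ s ∧ ∃ n, n ∈ N ∧
    ∃ a, a ∈ N ∧ ∃ b, b ∈ N ∧ q = pair n a ∧ p = pair (insert n n) b ∧ pair a b ∈ F) := h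
  have key : ∀ n y, pair (numeral n) y ∈ s ↔ y = c n := by
    intro n
    induction n with
    | zero =>
      intro y
      constructor
      · intro hp
        rcases ((h _).1 hp).2 with he | ⟨q, -, n, -, a, -, b, -, -, he, -⟩
        · exact (pair_inj.1 he).2
        · exact absurd (pair_inj.1 he).1.symm (succ_ne_empty n)
      · rintro rfl
        exact (h _).2 ⟨pair_mem_prod.2 ⟨omega_zero, hc 0⟩, Or.inl rfl⟩
    | succ n ih =>
      intro y
      constructor
      · intro hp
        rcases ((h _).1 hp).2 with he | ⟨q, hq, n', -, a, -, b, -, rfl, he, hF⟩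
        · exact absurd (pair_inj.1 he).1 (succ_ne_empty _)
        · obtain ⟨h₁, rfl⟩ := pair_inj.1 he
          obtain rfl := succ_inj h₁
          rw [ih] at hq
          subst hq
          exact (hFc n y).1 hF
      · rintro rfl
        have hn := mem_omega_iff_numeral.2 ⟨n, rfl⟩
        refine (h _).2 ⟨pair_mem_prod.2 ⟨omega_succ hn, hc _⟩, Or.inr ⟨_, (ih _).2 rfl, _,
          mem_of_mem hN (omega_mem hN) hn, _, mem_of_mem hN hx (hc n), _,
          mem_of_mem hN hx (hc (n + 1)), rfl, rfl, (hFc n _).2 rfl⟩⟩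
  refine ⟨s, hs, ⟨fun p hp => ((h p).1 hp).1, fun z hz => ?_⟩, key⟩
  obtain ⟨n, rfl⟩ := mem_omega_iff_numeral.1 hz
  exact ⟨c n, (key n _).2 rfl, fun y hy => (key n y).1 hy⟩

/-- Choosing least witnesses below an ordinal gives a function of the model. -/
theorem exists_func_least (hM : IsZFCModel M) {k : ℕ}
    (P : Set ZFSet.{u} → (Fin (k + 2) → ZFSet.{u}) → Prop) [hP : UDef P] {a b : ZFSet.{u}}
    (ha : a ∈ M) (hb : b ∈ M) (hbo : b.IsOrdinal) (p : Fin k → ZFSet.{u}) (hp : ∀ i, p i ∈ M)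
    (hex : ∀ x ∈ a, ∃ y ∈ b, P M (Matrix.vecCons x (Matrix.vecCons y p))) :
    ∃ f ∈ M, IsFunc a b f ∧ ∀ x y, pair x y ∈ f → P M (Matrix.vecCons x (Matrix.vecCons y p)) := by
  have hQ : UDef (n := k + 1) (fun M w => ∃ x, x ∈ M ∧ ∃ y, y ∈ M ∧ w 0 = pair x y ∧
      P M (Matrix.vecCons x (Matrix.vecCons y fun i => w i.succ)) ∧ ∀ z, z ∈ y →
      ¬ P M (Matrix.vecCons x (Matrix.vecCons z fun i => w i.succ))) := by
    have h₁ : UDef (n := k + 3) (fun M w => P M (Matrix.vecCons (w (Fin.last (k + 1)).castSucc)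
      (Matrix.vecCons (w (Fin.last (k + 2))) fun i => w i.succ.castSucc.castSucc))) := by
      refine (hP.reindex (n := k + 3) (Matrix.vecCons (Fin.last (k + 1)).castSucc
        (Matrix.vecCons (Fin.last (k + 2)) fun i => i.succ.castSucc.castSucc))).congr
          fun M _ v _ => iff_of_eq (congrArg (P M) (funext fun i => ?_))
      refine Fin.cases rfl (fun i => ?_) i
      refine Fin.cases rfl (fun i => rfl) i
    have h₂ : UDef (n := k + 4) (fun M w => P M (Matrix.vecCons
      (w (Fin.last (k + 1)).castSucc.castSucc)
      (Matrix.vecCons (w (Fin.last (k + 3))) fun i => w i.succ.castSucc.castSucc.castSucc))) := by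
      refine (hP.reindex (n := k + 4) (Matrix.vecCons (Fin.last (k + 1)).castSucc.castSucc
        (Matrix.vecCons (Fin.last (k + 3)) fun i => i.succ.castSucc.castSucc.castSucc))).congr
          fun M _ v _ => iff_of_eq (congrArg (P M) (funext fun i => ?_))
      refine Fin.cases rfl (fun i => ?_) i
      refine Fin.cases rfl (fun i => rfl) i
    infer_instance
  obtain ⟨f, hf, h⟩ := exists_sep hM (hP := hQ) (prod_mem hM ha hb) p hp
  have h : ∀ q, q ∈ f ↔ q ∈ prod a b ∧ ∃ x, x ∈ M ∧ ∃ y, y ∈ M ∧ q = pair x y ∧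
    P M (Matrix.vecCons x (Matrix.vecCons y p)) ∧ ∀ z, z ∈ y →
      ¬ P M (Matrix.vecCons x (Matrix.vecCons z p)) := h
  have h' : ∀ x y, pair x y ∈ f ↔ (x ∈ a ∧ y ∈ b) ∧ P M (Matrix.vecCons x (Matrix.vecCons y p)) ∧
      ∀ z, z ∈ y → ¬ P M (Matrix.vecCons x (Matrix.vecCons z p)) := by
    intro x y
    rw [h, pair_mem_prod]
    refine and_congr_right fun hxy => ⟨?_, fun h => ⟨x, mem_of_mem hM ha hxy.1, y,
      mem_of_mem hM hb hxy.2, rfl, h⟩⟩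
    rintro ⟨x', -, y', -, he, h⟩
    obtain ⟨rfl, rfl⟩ := pair_inj.1 he
    exact h
  refine ⟨f, hf, ⟨fun q hq => ((h q).1 hq).1, fun x hx => ?_⟩, fun x y hxy => ((h' x y).1 hxy).2.1⟩
  obtain ⟨y, ⟨hy, hPy⟩, hmin⟩ := mem_wf.has_min
    {y | y ∈ b ∧ P M (Matrix.vecCons x (Matrix.vecCons y p))} (hex x hx)
  have hmin : ∀ z ∈ b, z ∈ y → ¬ P M (Matrix.vecCons x (Matrix.vecCons z p)) :=
    fun z hz hzy hPz => hmin z ⟨hz, hPz⟩ hzy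
  refine ⟨y, (h' x y).2 ⟨⟨hx, hy⟩, hPy, fun z hz => hmin z (hbo.mem_trans hz hy) hz⟩,
    fun z hz => ?_⟩
  obtain ⟨⟨-, hz⟩, hPz, hmin'⟩ := (h' x z).1 hz
  rcases (hbo.mem hz).mem_trichotomous (hbo.mem hy) with hzy | rfl | hyz
  · exact absurd hPz (hmin z hz hzy)
  · rfl
  · exact absurd hPy (hmin' y hyz)

theorem restrict_mem (hM : IsZFCModel M) {a b f r : ZFSet.{u}} (hb : b ∈ M)
    (hbo : b.IsOrdinal) (hf : f ∈ M) (hfab : IsFunc a b f) (hr : r ∈ M) (hra : r ⊆ a) :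
    ∃ g ∈ M, IsFunc r b g ∧ ∀ x y, pair x y ∈ g → pair x y ∈ f :=
  exists_func_least hM (k := 1) (fun _ v => pair (v 0) (v 1) ∈ v 2) hr hb hbo ![f] (by simpa)
    fun x hx => let ⟨w, hw, _⟩ := hfab.2 x (hra hx)
      ⟨w, (pair_mem_prod.1 (hfab.1 hw)).2, hw⟩

theorem IsFunc.eq {a b f x y z : ZFSet.{u}} (h : IsFunc a b f) (hy : pair x y ∈ f)
    (hz : pair x z ∈ f) : y = z :=
  (h.2 x (pair_mem_prod.1 (h.1 hy)).1).unique hy hz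

theorem IsFunc.exists_eq {a b f x : ZFSet.{u}} (h : IsFunc a b f) (hx : x ∈ a) :
    ∃ y ∈ b, pair x y ∈ f :=
  let ⟨y, hy, _⟩ := h.2 x hx
  ⟨y, (pair_mem_prod.1 (h.1 hy)).2, hy⟩

/-- If a limit ordinal has a cofinal map from `ω` in `N` and regularity passes from `M` to `N`,
then it has a cofinal map from `ω` in `M`. -/
theorem cofOmegaIn_of_regular (hM : IsZFCModel M) (hN : IsZFCModel N) {l : ZFSet.{u}} (hl : l ∈ M)
    (hlN : l ∈ N) (hlo : l.IsOrdinal) (hl0 : ∅ ∈ l) (hls : ∀ x ∈ l, insert x x ∈ l)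
    (hrel : ∀ f ∈ M, f ⊆ prod l l → f ∈ N)
    (hreg : ∀ α : ZFSet.{u}, α ∈ M → RegularIn M α → RegularIn N α) (h : CofOmegaIn N l) :
    CofOmegaIn M l := by
  obtain ⟨s, hs, hsf, hsc⟩ := h
  obtain ⟨d, ⟨hd, f, hf, hff, hfc⟩, hmin⟩ := mem_wf.has_min
    {d | (d ∈ l ∨ d = l) ∧ ∃ f ∈ M, IsFunc d l f ∧ CofinalIn d l f} (by
      obtain ⟨f, hf, hff, hfe⟩ := exists_func_least hM (k := 0) (fun _ v => v 1 = v 0) hl hl hlo ![]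
        (fun i => i.elim0) (fun x hx => ⟨x, hx, rfl⟩)
      refine ⟨l, Or.inr rfl, f, hf, hff, fun g hg => ⟨g, hg, ?_⟩⟩
      obtain ⟨y, -, hy⟩ := IsFunc.exists_eq hff hg
      exact ⟨y, hy, Or.inr (hfe g y hy).symm⟩)
  have hdl : d ⊆ l := by
    rcases hd with hd | rfl
    exacts [hlo.subset_of_mem hd, fun x hx => hx]
  have hdM : d ∈ M := by
    rcases hd with hd | rfl
    exacts [mem_of_mem hM hl hd, hl]
  have hdo : d.IsOrdinal := by
    rcases hd with hd | rfl
    exacts [hlo.mem hd, hlo]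
  have hmin : ∀ e ∈ d, ∀ f ∈ M, IsFunc e l f → ¬ CofinalIn e l f :=
    fun e he f hf hff hfc => hmin e ⟨Or.inl (hdl he), f, hf, hff, hfc⟩ he
  -- restrictions of `f` to smaller ordinals are bounded
  have hbdd : ∀ r ∈ d, ∃ z ∈ l, ∀ x ∈ r, ∀ y ∈ l, pair x y ∈ f → y ∈ z := by
    intro r hr
    obtain ⟨g, hg, hgf, hgs⟩ := restrict_mem hM hl hlo hf hff (mem_of_mem hM hdM hr)
      (hdo.subset_of_mem hr)
    have := hmin r hr g hg hgf
    simp only [CofinalIn, not_forall] at this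
    obtain ⟨z, hz, h⟩ := this
    refine ⟨z, hz, fun x hx y hy hxy => ?_⟩
    obtain ⟨y', hy', hxy'⟩ := IsFunc.exists_eq hgf hx
    obtain rfl := IsFunc.eq hff (hgs _ _ hxy') hxy
    rcases (hlo.mem hz).mem_trichotomous (hlo.mem hy) with hzy | rfl | hyz
    · exact absurd ⟨x, hx, y', hxy', Or.inl hzy⟩ h
    · exact absurd ⟨x, hx, z, hxy', Or.inr rfl⟩ h
    · exact hyz
  have hds : ∀ r ∈ d, insert r r ∈ d := by
    intro r hr
    have hro := hdo.mem hr
    rcases (isOrdinal_succ hro).mem_trichotomous hdo with h | rfl | h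
    · exact h
    · exfalso
      obtain ⟨z, hz, hb⟩ := hbdd r hr
      obtain ⟨y, hy, hry⟩ := IsFunc.exists_eq hff hr
      obtain ⟨m, hm, hzm, hym⟩ : ∃ m ∈ l, (z ∈ m ∨ z = m) ∧ y ∈ m := by
        rcases (hlo.mem hz).mem_trichotomous (hlo.mem hy) with h | rfl | h
        · exact ⟨_, hls y hy, Or.inl (mem_insert_of_mem _ h), mem_insert _ _⟩
        · exact ⟨_, hls z hz, Or.inl (mem_insert _ _), mem_insert _ _⟩
        · exact ⟨z, hz, Or.inr rfl, h⟩
      obtain ⟨x, hx, y', hxy', hmy⟩ := hfc m hm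
      have hy'l := (pair_mem_prod.1 (hff.1 hxy')).2
      have : y' ∈ m := by
        rcases mem_insert_iff.1 hx with rfl | hx
        · exact IsFunc.eq hff hry hxy' ▸ hym
        · have := hb x hx y' hy'l hxy'
          rcases hzm with hzm | rfl
          exacts [(hlo.mem hm).mem_trans this hzm, this]
      rcases hmy with h | rfl
      exacts [mem_asymm h this, mem_irrefl _ this]
    · rcases mem_insert_iff.1 h with rfl | h
      exacts [absurd hr (mem_irrefl _), absurd hr (mem_asymm h)]
  have hdreg : RegularIn M d := by
    intro b hb g hg hgf hgc
    obtain ⟨e, he, hef, hee⟩ := exists_func_least hM (k := 4)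
      (fun _ v => ∃ r, r ∈ v 2 ∧ pair (v 0) r ∈ v 3 ∧
        ∀ x, x ∈ r → ∀ y, y ∈ v 5 → pair x y ∈ v 4 → y ∈ v 1)
      (mem_of_mem hM hdM hb) hl hlo ![d, g, f, l] (forall_vec₄ hdM hg hf hl) (fun x hx => by
        obtain ⟨r, hr, hxr⟩ := IsFunc.exists_eq hgf hx
        obtain ⟨z, hz, hrz⟩ := hbdd r hr
        exact ⟨z, hz, r, hr, hxr, hrz⟩)
    refine hmin b hb e he hef fun γ hγ => ?_
    obtain ⟨x, hx, y, hxy, hγy⟩ := hfc γ hγ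
    obtain ⟨ξ, hξ, r, hξr, hxr⟩ := hgc _ (hds x hx)
    have hxr : x ∈ r := by
      have hr := hdo.mem (pair_mem_prod.1 (hgf.1 hξr)).2
      rcases hxr with h | rfl
      exacts [hr.mem_trans (mem_insert _ _) h, mem_insert _ _]
    obtain ⟨z, hz, hξz⟩ := IsFunc.exists_eq hef hξ
    obtain ⟨r', hr', hξr', hr'z⟩ := hee _ _ hξz
    have hξr' : pair ξ r' ∈ g := hξr'
    obtain rfl := IsFunc.eq hgf hξr hξr'
    have hyz : y ∈ z := hr'z x hxr y (pair_mem_prod.1 (hff.1 hxy)).2 hxy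
    refine ⟨ξ, hξ, z, hξz, Or.inl ?_⟩
    rcases hγy with h | rfl
    exacts [(hlo.mem hz).mem_trans h hyz, hyz]
  have hdN : d ∈ N := by
    rcases hd with hd | rfl
    exacts [mem_of_mem hN hlN hd, hlN]
  have hfN : f ∈ N := hrel f hf fun p hp => by
    obtain ⟨x, hx, y, hy, rfl⟩ := mem_prod.1 (hff.1 hp)
    exact pair_mem_prod.2 ⟨hdl hx, hy⟩
  have hd0 : d ≠ ∅ := by
    rintro rfl
    obtain ⟨x, hx, -⟩ := hfc _ hl0
    exact notMem_empty _ hx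
  rcases hdo.mem_trichotomous isOrdinal_omega with hlt | rfl | hgt
  · rcases mem_omega_iff.1 hlt with rfl | ⟨m, -, rfl⟩
    · exact absurd rfl hd0
    · exact absurd (hds m (mem_insert _ _)) (mem_irrefl _)
  · exact ⟨f, hf, hff, hfc⟩
  · exfalso
    obtain ⟨g, hg, hgf, hgs⟩ := exists_func_least hN (k := 2)
      (fun N v => ∃ y, y ∈ N ∧ ∃ z, z ∈ N ∧ pair (v 0) y ∈ v 2 ∧ pair (v 1) z ∈ v 3 ∧
        (y ∈ z ∨ y = z)) (omega_mem hN) hdN hdo ![s, f] (forall_vec₂ hs hfN) (fun n hn => by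
        obtain ⟨y, hy, hny⟩ := IsFunc.exists_eq hsf hn
        obtain ⟨x, hx, z, hxz, hyz⟩ := hfc y hy
        exact ⟨x, hx, y, mem_of_mem hN hlN hy, z,
          mem_of_mem hN hlN (pair_mem_prod.1 (hff.1 hxz)).2, hny, hxz, hyz⟩)
    refine hreg d hdM hdreg omega hgt g hg hgf fun γ hγ => ?_
    obtain ⟨z, hz, hγz⟩ := hbdd γ hγ
    obtain ⟨n, hn, y, hny, hzy⟩ := hsc z hz
    obtain ⟨x, hx, hnx⟩ := IsFunc.exists_eq hgf hn
    obtain ⟨y', -, w, -, hny', hxw, hyw⟩ := hgs n x hnx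
    have hny' : pair n y' ∈ s := hny'
    have hxw : pair x w ∈ f := hxw
    obtain rfl := IsFunc.eq hsf hny hny'
    refine ⟨n, hn, x, hnx, ?_⟩
    rcases (hdo.mem hγ).mem_trichotomous (hdo.mem hx) with h | h | h
    · exact Or.inl h
    · exact Or.inr h
    · exfalso
      have hw := (pair_mem_prod.1 (hff.1 hxw)).2
      have hwz := hγz x h w hw hxw
      have hzo := hlo.mem hz
      have hyz : y ∈ z := by
        rcases hyw with h | rfl
        exacts [hzo.mem_trans h hwz, hwz]
      rcases hzy with h | rfl
      exacts [mem_asymm h hyz, mem_irrefl _ hyz]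

end ZFModel

namespace ZFModel

universe u

variable {M : Set ZFSet.{u}}

open ZFSet

theorem exists_rel (hM : IsZFCModel M) {k : ℕ}
    (P : Set ZFSet.{u} → (Fin (k + 2) → ZFSet.{u}) → Prop) [hP : UDef P] {a b : ZFSet.{u}}
    (ha : a ∈ M) (hb : b ∈ M) (p : Fin k → ZFSet.{u}) (hp : ∀ i, p i ∈ M) :
    ∃ F ∈ M, F ⊆ prod a b ∧ ∀ x y, pair x y ∈ F ↔
      (x ∈ a ∧ y ∈ b) ∧ P M (Matrix.vecCons x (Matrix.vecCons y p)) := by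
  have hQ : UDef (n := k + 1) (fun M w => ∃ x, x ∈ M ∧ ∃ y, y ∈ M ∧ w 0 = pair x y ∧
      P M (Matrix.vecCons x (Matrix.vecCons y fun i => w i.succ))) := by
    have h₁ : UDef (n := k + 3) (fun M w => P M (Matrix.vecCons (w (Fin.last (k + 1)).castSucc)
      (Matrix.vecCons (w (Fin.last (k + 2))) fun i => w i.succ.castSucc.castSucc))) := by
      refine (hP.reindex (n := k + 3) (Matrix.vecCons (Fin.last (k + 1)).castSucc
        (Matrix.vecCons (Fin.last (k + 2)) fun i => i.succ.castSucc.castSucc))).congr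
          fun M _ v _ => iff_of_eq (congrArg (P M) (funext fun i => ?_))
      refine Fin.cases rfl (fun i => ?_) i
      refine Fin.cases rfl (fun i => rfl) i
    infer_instance
  obtain ⟨f, hf, h⟩ := exists_sep hM (hP := hQ) (prod_mem hM ha hb) p hp
  have h : ∀ q, q ∈ f ↔ q ∈ prod a b ∧ ∃ x, x ∈ M ∧ ∃ y, y ∈ M ∧ q = pair x y ∧
    P M (Matrix.vecCons x (Matrix.vecCons y p)) := h
  refine ⟨f, hf, fun q hq => ((h q).1 hq).1, fun x y => ?_⟩
  rw [h, pair_mem_prod]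
  refine and_congr_right fun hxy => ⟨?_, fun h => ⟨x, mem_of_mem hM ha hxy.1, y,
    mem_of_mem hM hb hxy.2, rfl, h⟩⟩
  rintro ⟨x', -, y', -, he, h⟩
  obtain ⟨rfl, rfl⟩ := pair_inj.1 he
  exact h

theorem exists_choice (hM : IsZFCModel M) {k : ℕ}
    (P : Set ZFSet.{u} → (Fin (k + 2) → ZFSet.{u}) → Prop) [hP : UDef P] {a b : ZFSet.{u}}
    (ha : a ∈ M) (hb : b ∈ M) (p : Fin k → ZFSet.{u}) (hp : ∀ i, p i ∈ M)
    (hex : ∀ x ∈ a, ∃ y ∈ b, P M (Matrix.vecCons x (Matrix.vecCons y p))) :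
    ∃ f ∈ M, IsFunc a b f ∧ ∀ x y, pair x y ∈ f → P M (Matrix.vecCons x (Matrix.vecCons y p)) := by
  obtain ⟨R, hR, hRab, hRP⟩ := exists_rel hM P ha hb p hp
  obtain ⟨q, hq, hq'⟩ := exists_powerset hM hR
  obtain ⟨S, hS, hS'⟩ := exists_sep hM (k := 2) (P := fun M v => ∃ i, i ∈ v 1 ∧
    ∀ e, e ∈ M → (e ∈ v 0 ↔ e ∈ v 2 ∧ ∃ x, x ∈ M ∧ e = pair i x)) hq ![a, R] (forall_vec₂ ha hR)
  have hS' : ∀ s, s ∈ S ↔ s ∈ q ∧ ∃ i, i ∈ a ∧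
    ∀ e, e ∈ M → (e ∈ s ↔ e ∈ R ∧ ∃ x, x ∈ M ∧ e = pair i x) := hS'
  have h : ↥M ⊨ choiceAx := hM.2.realize_of_mem _ (Or.inl (Or.inl (by simp)))
  simp only [choiceAx, Sentence.Realize, Formula.Realize, BoundedFormula.realize_all,
    BoundedFormula.realize_ex, BoundedFormula.realize_imp, BoundedFormula.realize_inf,
    BoundedFormula.realize_not, realize_mem', realize_eq'] at h
  have h := h ⟨S, hS⟩
  have h : ((∀ s : ↥M, (s : ZFSet) ∈ S → ∃ x : ↥M, (x : ZFSet) ∈ (s : ZFSet)) ∧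
    (∀ s t : ↥M, ((s : ZFSet) ∈ S ∧ (t : ZFSet) ∈ S) ∧ ¬ (s : ZFSet) = t →
      ∀ x : ↥M, ¬ ((x : ZFSet) ∈ (s : ZFSet) ∧ (x : ZFSet) ∈ (t : ZFSet)))) →
    ∃ C : ↥M, ∀ s : ↥M, (s : ZFSet) ∈ S → ∃ x : ↥M,
      ((x : ZFSet) ∈ (s : ZFSet) ∧ (x : ZFSet) ∈ (C : ZFSet)) ∧
      ∀ y : ↥M, (y : ZFSet) ∈ (s : ZFSet) ∧ (y : ZFSet) ∈ (C : ZFSet) → (y : ZFSet) = x := h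
  refine Exists.elim (h ⟨?_, ?_⟩) fun C hC => ?_
  · rintro ⟨s, hs⟩ hsS
    obtain ⟨-, i, hi, h⟩ := (hS' s).1 hsS
    obtain ⟨y, hy, hPy⟩ := hex i hi
    have hiM := mem_of_mem hM ha hi
    have hyM := mem_of_mem hM hb hy
    exact ⟨⟨_, pair_mem hM hiM hyM⟩, (h _ (pair_mem hM hiM hyM)).2
      ⟨(hRP _ _).2 ⟨⟨hi, hy⟩, hPy⟩, y, hyM, rfl⟩⟩
  · rintro ⟨s, hs⟩ ⟨t, ht⟩ ⟨⟨hsS, htS⟩, hne⟩ ⟨x, hx⟩ ⟨hxs, hxt⟩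
    obtain ⟨-, i, hi, h⟩ := (hS' s).1 hsS
    obtain ⟨-, i', hi', h'⟩ := (hS' t).1 htS
    obtain ⟨-, y, -, rfl⟩ := (h x hx).1 hxs
    obtain ⟨-, y', -, he⟩ := (h' _ hx).1 hxt
    obtain ⟨rfl, rfl⟩ := pair_inj.1 he
    refine hne ?_
    ext e
    exact ⟨fun he => (h' e (mem_of_mem hM hs he)).2 ((h e (mem_of_mem hM hs he)).1 he),
      fun he => (h e (mem_of_mem hM ht he)).2 ((h' e (mem_of_mem hM ht he)).1 he)⟩
  · obtain ⟨f, hf, hf'⟩ := exists_sep hM (k := 1) (P := fun _ v => v 0 ∈ v 1) hR ![(C : ZFSet)]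
      (by simp)
    have hf' : ∀ e, e ∈ f ↔ e ∈ R ∧ e ∈ (C : ZFSet) := hf'
    refine ⟨f, hf, ⟨fun e he => hRab ((hf' e).1 he).1, fun i hi => ?_⟩,
      fun x y hxy => ((hRP x y).1 ((hf' _).1 hxy).1).2⟩
    obtain ⟨s, hs, hs'⟩ := exists_sep hM (k := 1)
      (P := fun M v => ∃ x, x ∈ M ∧ v 0 = pair (v 1) x) hR ![i]
      (by simpa using mem_of_mem hM ha hi)
    have hs' : ∀ e, e ∈ s ↔ e ∈ R ∧ ∃ x, x ∈ M ∧ e = pair i x := hs'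
    have hsS : s ∈ S := (hS' s).2 ⟨(hq' _).2 ⟨hs, fun e he => ((hs' e).1 he).1⟩, i, hi,
      fun e _ => hs' e⟩
    obtain ⟨e, ⟨he, heC⟩, hu⟩ := hC ⟨s, hs⟩ hsS
    obtain ⟨heR, x, -, hex⟩ := (hs' _).1 he
    refine ⟨x, (hf' _).2 ⟨hex ▸ heR, hex ▸ heC⟩, fun y hy => ?_⟩
    have hyR := ((hf' _).1 hy).1
    have hyM := mem_of_mem hM hR hyR
    have := hu ⟨_, hyM⟩ ⟨(hs' _).2 ⟨hyR, y, right_mem_of_pair_mem hM hyM, rfl⟩, ((hf' _).1 hy).2⟩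
    exact (pair_inj.1 (this.trans hex)).2

/-- `M` contains a partial map from `A` whose range includes `B`. -/
def Cov (M : Set ZFSet.{u}) (A B : ZFSet.{u}) : Prop :=
  ∃ F ∈ M, (∀ a b b', pair a b ∈ F → pair a b' ∈ F → b = b') ∧ ∀ b ∈ B, ∃ a ∈ A, pair a b ∈ F

namespace Cov

variable {A A' B B' C : ZFSet.{u}}

theorem of_rel (hM : IsZFCModel M) {k : ℕ}
    (P : Set ZFSet.{u} → (Fin (k + 2) → ZFSet.{u}) → Prop) [hP : UDef P]
    (hA : A ∈ M) (hB : B ∈ M) (p : Fin k → ZFSet.{u}) (hp : ∀ i, p i ∈ M)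
    (huniq : ∀ a ∈ A, ∀ b ∈ B, ∀ b' ∈ B, P M (Matrix.vecCons a (Matrix.vecCons b p)) →
      P M (Matrix.vecCons a (Matrix.vecCons b' p)) → b = b')
    (hex : ∀ b ∈ B, ∃ a ∈ A, P M (Matrix.vecCons a (Matrix.vecCons b p))) : Cov M A B := by
  obtain ⟨F, hF, -, h⟩ := exists_rel hM P hA hB p hp
  refine ⟨F, hF, fun a b b' hb hb' => ?_, fun b hb => ?_⟩
  · have h₁ := (h _ _).1 hb
    have h₂ := (h _ _).1 hb'
    exact huniq a h₁.1.1 b h₁.1.2 b' h₂.1.2 h₁.2 h₂.2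
  · obtain ⟨a, ha, hab⟩ := hex b hb
    exact ⟨a, ha, (h _ _).2 ⟨⟨ha, hb⟩, hab⟩⟩

theorem of_subset (hM : IsZFCModel M) (hA : A ∈ M) (h : B ⊆ A) : Cov M A B := by
  obtain ⟨F, hF, h₁, h₂⟩ := of_rel hM (k := 0) (fun _ v => v 0 = v 1) hA hA ![] (fun i => i.elim0)
    (fun a _ b _ b' _ (h : a = b) (h' : a = b') => h.symm.trans h') (fun b hb => ⟨b, hb, rfl⟩)
  exact ⟨F, hF, h₁, fun b hb => h₂ b (h hb)⟩

theorem mono (h : Cov M A B) (hA : A ⊆ A') : Cov M A' B :=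
  let ⟨F, hF, h₁, h₂⟩ := h
  ⟨F, hF, h₁, fun b hb => let ⟨a, ha, hab⟩ := h₂ b hb; ⟨a, hA ha, hab⟩⟩

theorem trans (hM : IsZFCModel M) (hA : A ∈ M) (hB : B ∈ M) (hC : C ∈ M) (h : Cov M A B)
    (h' : Cov M B C) : Cov M A C := by
  obtain ⟨F, hF, hu, he⟩ := h
  obtain ⟨G, hG, hu', he'⟩ := h'
  refine of_rel hM (k := 3) (fun _ v => ∃ b, b ∈ v 4 ∧ pair (v 0) b ∈ v 2 ∧ pair b (v 1) ∈ v 3)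
    hA hC ![F, G, B] (forall_vec₃ hF hG hB) ?_ ?_
  · rintro a - c - c' - ⟨b, -, h₁, h₂⟩ ⟨b', -, h₁', h₂'⟩
    obtain rfl := hu _ _ _ h₁ h₁'
    exact hu' _ _ _ h₂ h₂'
  · intro c hc
    obtain ⟨b, hb, hbc⟩ := he' c hc
    obtain ⟨a, ha, hab⟩ := he b hb
    exact ⟨a, ha, b, hb, hab, hbc⟩

theorem prod (hM : IsZFCModel M) (hA : A ∈ M) (hB : B ∈ M) (hA' : A' ∈ M) (hB' : B' ∈ M)
    (h : Cov M A B) (h' : Cov M A' B') : Cov M (prod A A') (prod B B') := by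
  obtain ⟨F, hF, hu, he⟩ := h
  obtain ⟨G, hG, hu', he'⟩ := h'
  refine of_rel hM (k := 2) (fun M v => ∃ a, a ∈ M ∧ ∃ a', a' ∈ M ∧ ∃ b, b ∈ M ∧ ∃ b', b' ∈ M ∧
    v 0 = pair a a' ∧ v 1 = pair b b' ∧ pair a b ∈ v 2 ∧ pair a' b' ∈ v 3)
    (prod_mem hM hA hA') (prod_mem hM hB hB') ![F, G] (forall_vec₂ hF hG) ?_ ?_
  · rintro p - q - q' - ⟨a, -, a', -, b, -, b', -, rfl, rfl, h₁, h₂⟩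
      ⟨c, -, c', -, d, -, d', -, he, rfl, h₁', h₂'⟩
    obtain ⟨rfl, rfl⟩ := pair_inj.1 he
    rw [hu _ _ _ h₁ h₁', hu' _ _ _ h₂ h₂']
  · intro p hp
    obtain ⟨b, hb, b', hb', rfl⟩ := mem_prod.1 hp
    obtain ⟨a, ha, hab⟩ := he b hb
    obtain ⟨a', ha', hab'⟩ := he' b' hb'
    exact ⟨pair a a', pair_mem_prod.2 ⟨ha, ha'⟩, a, mem_of_mem hM hA ha, a', mem_of_mem hM hA' ha',
      b, mem_of_mem hM hB hb, b', mem_of_mem hM hB' hb', rfl, rfl, hab, hab'⟩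

theorem succ (hM : IsZFCModel M) (hA : A ∈ M) (hB : B ∈ M) (hAA : Cov M A (ZFSet.prod A A))
    (h0 : ∅ ∈ A) (h1 : insert ∅ ∅ ∈ A) (h : Cov M A B) : Cov M A (insert B B) := by
  refine trans hM hA (prod_mem hM hA hA) (insert_mem hM hB hB) hAA ?_
  obtain ⟨F, hF, hu, he⟩ := h
  refine of_rel hM (k := 3) (fun _ v => (v 0 = pair ∅ ∅ ∧ v 1 = v 2) ∨
    ∃ x, x ∈ v 4 ∧ v 0 = pair (insert ∅ ∅) x ∧ pair x (v 1) ∈ v 3)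
    (prod_mem hM hA hA) (insert_mem hM hB hB) ![B, F, A] (forall_vec₃ hB hF hA) ?_ ?_
  · rintro p - b - b' - (⟨rfl, h⟩ | ⟨x, -, rfl, h⟩) (⟨h₁, h₂⟩ | ⟨x', -, h₁, h₂⟩)
    · exact h.trans h₂.symm
    · exact absurd (pair_inj.1 h₁).1.symm (succ_ne_empty _)
    · exact absurd (pair_inj.1 h₁).1 (succ_ne_empty _)
    · obtain ⟨-, rfl⟩ := pair_inj.1 h₁
      exact hu _ _ _ h h₂
  · intro b hb
    rcases mem_insert_iff.1 hb with rfl | hb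
    · exact ⟨_, pair_mem_prod.2 ⟨h0, h0⟩, Or.inl ⟨rfl, rfl⟩⟩
    · obtain ⟨a, ha, hab⟩ := he b hb
      exact ⟨_, pair_mem_prod.2 ⟨h1, ha⟩, Or.inr ⟨a, ha, rfl, hab⟩⟩

theorem finite (h : Cov M A B) (hA : {x | x ∈ A}.Finite) : {x | x ∈ B}.Finite := by
  obtain ⟨F, -, hu, he⟩ := h
  choose! g hg using he
  refine Set.Finite.of_finite_image (f := g) (hA.subset ?_) ?_
  · rintro _ ⟨b, hb, rfl⟩
    exact (hg b hb).1
  · intro b hb b' hb' e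
    exact hu _ _ _ (hg b hb).2 (e ▸ (hg b' hb').2)

end Cov

theorem finite_of_mem_omega {n : ZFSet.{u}} (hn : n ∈ omega.{u}) : {x | x ∈ n}.Finite := by
  refine omega_induction (p := fun n => {x | x ∈ n}.Finite) (by simp) (fun n _ h => ?_) n hn
  refine (h.insert n).subset fun x hx => ?_
  simpa using hx

theorem infinite_omega : {x | x ∈ omega.{u}}.Infinite := by
  have hlt : StrictMono fun n => rank (numeral.{u} n) := strictMono_nat_of_lt_succ fun n =>
    rank_lt_of_mem (mem_insert _ _)
  have : Function.Injective numeral.{u} := fun a b h => hlt.injective (congrArg rank h)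
  exact (Set.infinite_range_of_injective this).mono
    (by rintro _ ⟨n, rfl⟩; exact mem_omega_iff_numeral.2 ⟨n, rfl⟩)

theorem CardinalIn.not_cov (hM : IsZFCModel M) {μ β : ZFSet.{u}} (h : CardinalIn M μ) (hμ : μ ∈ M)
    (hβ : β ∈ μ) : ¬ Cov M β μ := by
  rintro ⟨F, hF, hu, he⟩
  obtain ⟨f, hf, hff, hfP⟩ := exists_func_least hM (k := 2)
    (fun _ v => pair (v 0) (v 1) ∈ v 2 ∨ ∀ z, z ∈ v 3 → ¬ pair (v 0) z ∈ v 2)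
    (mem_of_mem hM hμ hβ) hμ h.1 ![F, μ] (forall_vec₂ hF hμ) (fun x hx => by
      by_cases hz : ∃ z ∈ μ, pair x z ∈ F
      · obtain ⟨z, hz, hxz⟩ := hz
        exact ⟨z, hz, Or.inl hxz⟩
      · push Not at hz
        exact ⟨β, hβ, Or.inr hz⟩)
  refine h.2 β hβ ⟨f, hf, hff, fun γ hγ => ?_⟩
  obtain ⟨x, hx, hxγ⟩ := he γ hγ
  obtain ⟨y, hy, hxy⟩ := IsFunc.exists_eq hff hx
  have : pair x y ∈ F ∨ ∀ z, z ∈ μ → ¬ pair x z ∈ F := hfP _ _ hxy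
  rcases this with h | h
  · obtain rfl := hu _ _ _ hxγ h
    exact ⟨x, hx, hxy⟩
  · exact absurd hxγ (h γ hγ)

theorem exists_cov_of_not_cardinalIn {μ : ZFSet.{u}} (h : ¬ CardinalIn M μ) (hμ : μ.IsOrdinal) :
    ∃ β ∈ μ, Cov M β μ := by
  simp only [CardinalIn, hμ, true_and, not_forall, not_not] at h
  obtain ⟨β, hβ, f, hf, hff, h⟩ := h
  exact ⟨β, hβ, f, hf, fun _ _ _ h h' => IsFunc.eq hff h h', h⟩

end ZFModel

namespace ZFModel

universe u

variable {M : Set ZFSet.{u}}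

open ZFSet

/-- Comparison of maxima of pairs of ordinals. -/
def MaxLt (a b a' b' : ZFSet.{u}) : Prop := (a ∈ a' ∨ a ∈ b') ∧ (b ∈ a' ∨ b ∈ b')

/-- Gödel's well-ordering of pairs of ordinals. -/
def GodelLt (a b a' b' : ZFSet.{u}) : Prop :=
  MaxLt a b a' b' ∨ (¬ MaxLt a' b' a b ∧ (a ∈ a' ∨ (a = a' ∧ b ∈ b')))

instance UDef.godelLt {n : ℕ} (i k l m : Fin n) :
    UDef.{u} (fun _ v => GodelLt (v i) (v k) (v l) (v m)) :=
  (inferInstance : UDef.{u} (fun _ v =>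
    ((v i ∈ v l ∨ v i ∈ v m) ∧ (v k ∈ v l ∨ v k ∈ v m)) ∨
    (¬ ((v l ∈ v i ∨ v l ∈ v k) ∧ (v m ∈ v i ∨ v m ∈ v k)) ∧
      (v i ∈ v l ∨ (v i = v l ∧ v k ∈ v m)))))

/-- The lexicographic key which realizes Gödel's ordering. -/
noncomputable def godelKey (a b : ZFSet.{u}) : Ordinal.{u} ×ₗ Ordinal.{u} ×ₗ Ordinal.{u} :=
  toLex (max (rank a) (rank b), toLex (rank a, rank b))

theorem godelLt_iff {a b a' b' : ZFSet.{u}} (ha : a.IsOrdinal) (hb : b.IsOrdinal)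
    (ha' : a'.IsOrdinal) (hb' : b'.IsOrdinal) :
    GodelLt a b a' b' ↔ godelKey a b < godelKey a' b' := by
  have h₁ : MaxLt a b a' b' ↔ max (rank a) (rank b) < max (rank a') (rank b') := by
    rw [max_lt_iff, lt_max_iff, lt_max_iff]
    simp only [MaxLt, ha.rank_lt_iff_mem ha', ha.rank_lt_iff_mem hb',
      hb.rank_lt_iff_mem ha', hb.rank_lt_iff_mem hb']
  have h₂ : MaxLt a' b' a b ↔ max (rank a') (rank b') < max (rank a) (rank b) := by
    rw [max_lt_iff, lt_max_iff, lt_max_iff]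
    simp only [MaxLt, ha'.rank_lt_iff_mem ha, ha'.rank_lt_iff_mem hb,
      hb'.rank_lt_iff_mem ha, hb'.rank_lt_iff_mem hb]
  rw [GodelLt, h₁, h₂, godelKey, godelKey, Prod.Lex.toLex_lt_toLex, Prod.Lex.toLex_lt_toLex]
  simp only [ha.rank_lt_iff_mem ha', hb.rank_lt_iff_mem hb', ha.rank_inj ha', not_lt]
  constructor
  · rintro (h | ⟨h, h'⟩)
    · exact Or.inl h
    · rcases h.lt_or_eq with h | h
      exacts [Or.inl h, Or.inr ⟨h, h'⟩]
  · rintro (h | ⟨h, h'⟩)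
    exacts [Or.inl h, Or.inr ⟨h.le, h'⟩]

theorem godelKey_inj {a b a' b' : ZFSet.{u}} (ha : a.IsOrdinal) (hb : b.IsOrdinal)
    (ha' : a'.IsOrdinal) (hb' : b'.IsOrdinal) (h : godelKey a b = godelKey a' b') :
    a = a' ∧ b = b' := by
  have h := congrArg (fun x => (ofLex x).2) h
  have h : (rank a, rank b) = (rank a', rank b') := congrArg ofLex h
  exact ⟨(ha.rank_inj ha').1 (Prod.ext_iff.1 h).1, (hb.rank_inj hb').1 (Prod.ext_iff.1 h).2⟩

theorem mem_succ_of_godelLt {a b a' b' : ZFSet.{u}} (ha : a.IsOrdinal) (hb : b.IsOrdinal)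
    (ha' : a'.IsOrdinal) (hb' : b'.IsOrdinal) (h : GodelLt a b a' b') {m : ZFSet.{u}}
    (hm : m.IsOrdinal) (ham : a' ∈ insert m m) (hbm : b' ∈ insert m m) :
    a ∈ insert m m ∧ b ∈ insert m m := by
  have key : max (rank a) (rank b) ≤ max (rank a') (rank b') := by
    rw [godelLt_iff ha hb ha' hb', godelKey, godelKey, Prod.Lex.toLex_lt_toLex] at h
    rcases h with h | h
    exacts [h.le, h.1.le]
  have hle : ∀ {x : ZFSet.{u}}, x.IsOrdinal → (x ∈ insert m m ↔ rank x ≤ rank m) := fun hx => by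
    rw [le_iff_lt_or_eq, mem_insert_iff, hx.rank_lt_iff_mem hm, hx.rank_inj hm, or_comm]
  rw [hle ha', hle hb'] at *
  rw [hle ha, hle hb]
  exact max_le_iff.1 (key.trans (max_le ham hbm))

theorem cov_prod_of_small (hM : IsZFCModel M) {α : ZFSet.{u}} (hα : α ∈ M) (ho : α.IsOrdinal)
    (hsmall : ∀ m ∈ α, ¬ Cov M (prod (insert m m) (insert m m)) α) : Cov M α (prod α α) := by
  obtain ⟨F, hF, h⟩ := exists_fixedPoint hM (k := 1)
    (fun _ v => ∃ z, z ∈ v 2 ∧ ∃ x, x ∈ v 2 ∧ ∃ y, y ∈ v 2 ∧ v 0 = pair z (pair x y) ∧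
      (∀ a, a ∈ v 2 → ∀ b, b ∈ v 2 → GodelLt a b x y → ∃ t, t ∈ z ∧ pair t (pair a b) ∈ v 1) ∧
      (∀ t, t ∈ z → ∃ a, a ∈ v 2 ∧ ∃ b, b ∈ v 2 ∧ GodelLt a b x y ∧ pair t (pair a b) ∈ v 1))
    (prod_mem hM hα (prod_mem hM hα hα)) ![α] (by simpa) (by
      rintro e - F G hFG ⟨z, hz, x, hx, y, hy, he, h₁, h₂⟩
      refine ⟨z, hz, x, hx, y, hy, he, fun a ha b hb hab => ?_, fun t ht => ?_⟩
      · obtain ⟨t, ht, h⟩ := h₁ a ha b hb hab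
        exact ⟨t, ht, hFG h⟩
      · obtain ⟨a, ha, b, hb, hab, h⟩ := h₂ t ht
        exact ⟨a, ha, b, hb, hab, hFG h⟩)
  have h : ∀ e, e ∈ F ↔ e ∈ prod α (prod α α) ∧ ∃ z, z ∈ α ∧ ∃ x, x ∈ α ∧ ∃ y, y ∈ α ∧
    e = pair z (pair x y) ∧
    (∀ a, a ∈ α → ∀ b, b ∈ α → GodelLt a b x y → ∃ t, t ∈ z ∧ pair t (pair a b) ∈ F) ∧
    (∀ t, t ∈ z → ∃ a, a ∈ α ∧ ∃ b, b ∈ α ∧ GodelLt a b x y ∧ pair t (pair a b) ∈ F) := h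
  have hT : ∀ z x y, pair z (pair x y) ∈ F ↔ (z ∈ α ∧ x ∈ α ∧ y ∈ α) ∧
      (∀ a ∈ α, ∀ b ∈ α, godelKey a b < godelKey x y → ∃ t ∈ z, pair t (pair a b) ∈ F) ∧
      (∀ t ∈ z, ∃ a ∈ α, ∃ b ∈ α, godelKey a b < godelKey x y ∧ pair t (pair a b) ∈ F) := by
    intro z x y
    rw [h, pair_mem_prod, pair_mem_prod]
    refine and_congr_right fun ⟨hz, hx, hy⟩ => ?_
    have hL : ∀ a ∈ α, ∀ b ∈ α, (GodelLt a b x y ↔ godelKey a b < godelKey x y) :=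
      fun a ha b hb => godelLt_iff (ho.mem ha) (ho.mem hb) (ho.mem hx) (ho.mem hy)
    constructor
    · rintro ⟨z', -, x', -, y', -, he, h₁, h₂⟩
      obtain ⟨rfl, he'⟩ := pair_inj.1 he
      obtain ⟨rfl, rfl⟩ := pair_inj.1 he'
      refine ⟨fun a ha b hb hab => h₁ a ha b hb ((hL a ha b hb).2 hab), fun t ht => ?_⟩
      obtain ⟨a, ha, b, hb, hab, h⟩ := h₂ t ht
      exact ⟨a, ha, b, hb, (hL a ha b hb).1 hab, h⟩
    · rintro ⟨h₁, h₂⟩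
      refine ⟨z, hz, x, hx, y, hy, rfl, fun a ha b hb hab => h₁ a ha b hb ((hL a ha b hb).1 hab),
        fun t ht => ?_⟩
      obtain ⟨a, ha, b, hb, hab, h⟩ := h₂ t ht
      exact ⟨a, ha, b, hb, (hL a ha b hb).2 hab, h⟩
  have hsub : ∀ {z q}, pair z q ∈ F → q ∈ prod α α := fun {z q} hq =>
    (pair_mem_prod.1 ((h _).1 hq).1).2
  clear h
  have hfun : ∀ z x y x' y', pair z (pair x y) ∈ F → pair z (pair x' y') ∈ F →
      ¬ godelKey x y < godelKey x' y' := by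
    intro z
    induction z using inductionOn with
    | _ z ih =>
      intro x y x' y' h h' hlt
      obtain ⟨⟨-, hx, hy⟩, -, h₂⟩ := (hT _ _ _).1 h
      obtain ⟨-, h₁, -⟩ := (hT _ _ _).1 h'
      obtain ⟨t, ht, hF₁⟩ := h₁ x hx y hy hlt
      obtain ⟨a, ha, b, hb, hab, hF₂⟩ := h₂ t ht
      exact ih t ht _ _ _ _ hF₂ hF₁ hab
  have hfun' : ∀ z x y x' y', pair z (pair x y) ∈ F → pair z (pair x' y') ∈ F →
      x = x' ∧ y = y' := by
    intro z x y x' y' h h'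
    obtain ⟨⟨-, hx, hy⟩, -⟩ := (hT _ _ _).1 h
    obtain ⟨⟨-, hx', hy'⟩, -⟩ := (hT _ _ _).1 h'
    exact godelKey_inj (ho.mem hx) (ho.mem hy) (ho.mem hx') (ho.mem hy')
      (le_antisymm (not_lt.1 (hfun _ _ _ _ _ h' h)) (not_lt.1 (hfun _ _ _ _ _ h h')))
  have hnotMem : ∀ z z' x y, pair z (pair x y) ∈ F → pair z' (pair x y) ∈ F → z ∉ z' := by
    intro z z' x y h h' hz
    obtain ⟨-, -, h₂⟩ := (hT _ _ _).1 h'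
    obtain ⟨a, -, b, -, hab, hF⟩ := h₂ z hz
    exact hfun _ _ _ _ _ hF h hab
  have hinj : ∀ z z' x y, pair z (pair x y) ∈ F → pair z' (pair x y) ∈ F → z = z' := by
    intro z z' x y h h'
    rcases (ho.mem ((hT _ _ _).1 h).1.1).mem_trichotomous (ho.mem ((hT _ _ _).1 h').1.1)
      with hz | hz | hz
    exacts [absurd hz (hnotMem _ _ _ _ h h'), hz, absurd hz (hnotMem _ _ _ _ h' h)]
  have htot : ∀ k : Ordinal.{u} ×ₗ Ordinal.{u} ×ₗ Ordinal.{u}, ∀ x ∈ α, ∀ y ∈ α,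
      godelKey x y = k → ∃ z ∈ α, pair z (pair x y) ∈ F := by
    intro k
    induction k using WellFoundedLT.induction with
    | _ k ih =>
      rintro x hx y hy rfl
      let S : ZFSet.{u} := ZFSet.sep (fun z => ∃ a ∈ α, ∃ b ∈ α,
        godelKey a b < godelKey x y ∧ pair z (pair a b) ∈ F) α
      have hS : ∀ z, z ∈ S ↔ z ∈ α ∧ ∃ a ∈ α, ∃ b ∈ α,
        godelKey a b < godelKey x y ∧ pair z (pair a b) ∈ F := fun z => mem_sep
      have hSα : S ⊆ α := fun z hz => ((hS z).1 hz).1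
      have hSo : S.IsOrdinal := by
        refine isOrdinal_iff_forall_mem_isOrdinal.2 ⟨fun z hz t ht => ?_,
          fun z hz => ho.mem (hSα hz)⟩
        obtain ⟨hzα, a, ha, b, hb, hab, hzF⟩ := (hS z).1 hz
        obtain ⟨a', ha', b', hb', hab', htF⟩ := ((hT _ _ _).1 hzF).2.2 t ht
        exact (hS t).2 ⟨ho.mem_trans ht hzα, a', ha', b', hb', hab'.trans hab, htF⟩
      rcases (hSo.subset_iff_eq_or_mem ho).1 hSα with hSe | hSm
      · exfalso
        obtain ⟨m, hm, hxm, hym⟩ : ∃ m ∈ α, x ∈ insert m m ∧ y ∈ insert m m := by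
          rcases (ho.mem hx).mem_trichotomous (ho.mem hy) with h | rfl | h
          · exact ⟨y, hy, mem_insert_of_mem _ h, mem_insert _ _⟩
          · exact ⟨x, hx, mem_insert _ _, mem_insert _ _⟩
          · exact ⟨x, hx, mem_insert _ _, mem_insert_of_mem _ h⟩
        refine hsmall m hm ?_
        have hmM := mem_of_mem hM hα hm
        have hsM := insert_mem hM hmM hmM
        refine Cov.of_rel hM (k := 1) (fun _ v => pair (v 1) (v 0) ∈ v 2) (prod_mem hM hsM hsM) hα
          ![F] (by simpa) ?_ ?_
        · intro p hp z _ z' _ hz hz'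
          obtain ⟨a, -, b, -, rfl⟩ := mem_prod.1 hp
          exact hinj z z' a b hz hz'
        · intro z hz
          obtain ⟨-, a, ha, b, hb, hab, hzF⟩ := (hS z).1 (hSe ▸ hz)
          have := mem_succ_of_godelLt (ho.mem ha) (ho.mem hb) (ho.mem hx) (ho.mem hy)
            ((godelLt_iff (ho.mem ha) (ho.mem hb) (ho.mem hx) (ho.mem hy)).2 hab) (ho.mem hm) hxm hym
          exact ⟨pair a b, pair_mem_prod.2 this, hzF⟩
      · refine ⟨S, hSm, (hT _ _ _).2 ⟨⟨hSm, hx, hy⟩, fun a ha b hb hab => ?_,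
          fun t ht => ((hS t).1 ht).2⟩⟩
        obtain ⟨t, ht, htF⟩ := ih _ hab a ha b hb rfl
        exact ⟨t, (hS t).2 ⟨ht, a, ha, b, hb, hab, htF⟩, htF⟩
  refine ⟨F, hF, fun z p p' hp hp' => ?_, fun p hp => ?_⟩
  · obtain ⟨a, -, b, -, rfl⟩ := mem_prod.1 (hsub hp)
    obtain ⟨a', -, b', -, rfl⟩ := mem_prod.1 (hsub hp')
    obtain ⟨rfl, rfl⟩ := hfun' _ _ _ _ _ hp hp'
    rfl
  · obtain ⟨a, ha, b, hb, rfl⟩ := mem_prod.1 hp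
    exact htot _ a ha b hb rfl

/-- Hessenberg's theorem in a transitive model: an infinite ordinal covers its square. -/
theorem cov_prod_self (hM : IsZFCModel M) (α : ZFSet.{u}) (hα : α ∈ M) (ho : α.IsOrdinal)
    (hω : omega ⊆ α) : Cov M α (prod α α) := by
  induction α using inductionOn with
  | _ α ih =>
    have hfin : ∀ {A : ZFSet.{u}}, {x | x ∈ A}.Finite → ¬ Cov M A α := fun hA h =>
      infinite_omega ((h.finite hA).subset fun x hx => hω hx)
    have hinf : ∀ m ∈ α, m ∈ omega ∨ omega ⊆ m := fun m hm =>
      (ho.mem hm).mem_or_subset isOrdinal_omega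
    by_cases hc : CardinalIn M α
    · refine cov_prod_of_small hM hα ho fun m hm hcov => ?_
      have hmM := mem_of_mem hM hα hm
      have hsM := insert_mem hM hmM hmM
      rcases hinf m hm with hmω | hmω
      · refine hfin (A := prod (insert m m) (insert m m)) ?_ hcov
        have := finite_of_mem_omega (omega_succ hmω)
        refine ((this.prod this).image fun q => pair q.1 q.2).subset ?_
        intro p hp
        obtain ⟨a, ha, b, hb, rfl⟩ := mem_prod.1 hp
        exact ⟨(a, b), ⟨ha, hb⟩, rfl⟩
      · have hmm := ih m hm hmM (ho.mem hm) hmω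
        have hms := Cov.succ hM hmM hmM hmm (hmω omega_zero) (hmω (omega_succ omega_zero))
          (Cov.of_subset hM hmM fun _ h => h)
        exact CardinalIn.not_cov hM hc hα hm ((hmm.trans hM hmM (prod_mem hM hmM hmM) (prod_mem hM hsM hsM)
          (hms.prod hM hmM hsM hmM hsM hms)).trans hM hmM (prod_mem hM hsM hsM) hα hcov)
    · obtain ⟨β, hβ, hcov⟩ := exists_cov_of_not_cardinalIn hc ho
      have hβM := mem_of_mem hM hα hβ
      rcases hinf β hβ with hβω | hβω
      · exact absurd hcov (hfin (finite_of_mem_omega hβω))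
      · exact (((ih β hβ hβM (ho.mem hβ) hβω).trans hM hβM (prod_mem hM hβM hβM)
          (prod_mem hM hα hα) (hcov.prod hM hβM hα hβM hα hcov))).mono (ho.subset_of_mem hβ)

/-- In a transitive model of ZFC, infinite successor cardinals are regular. -/
theorem regularIn_of_isCardSuccIn (hM : IsZFCModel M) {l μ : ZFSet.{u}} (hω : omega ⊆ l)
    (h : IsCardSuccIn M l μ) : RegularIn M μ := by
  obtain ⟨hμ, hc, hlμ, hmin⟩ := h
  have ho := hc.1
  have hl := mem_of_mem hM hμ hlμ
  have hlo := ho.mem hlμ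
  have hll := cov_prod_self hM l hl hlo hω
  have hcov : ∀ η ∈ μ, Cov M l η := by
    intro η
    induction η using inductionOn with
    | _ η ih =>
      intro hη
      rcases (ho.mem hη).mem_trichotomous hlo with h | rfl | h
      · exact Cov.of_subset hM hl (hlo.subset_of_mem h)
      · exact Cov.of_subset hM hl fun _ h => h
      · obtain ⟨β, hβ, hcov⟩ := exists_cov_of_not_cardinalIn (hmin η hη h) (ho.mem hη)
        have hηM := mem_of_mem hM hμ hη
        exact (ih β hβ (ho.mem_trans hβ hη)).trans hM hl (mem_of_mem hM hηM hβ) hηM hcov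
  intro β hβ f hf hff hfc
  have hβM := mem_of_mem hM hμ hβ
  obtain ⟨q, hq, hq'⟩ := exists_powerset hM (prod_mem hM hl hμ)
  obtain ⟨C, hC, hCf, hCP⟩ := exists_choice hM (k := 1) (fun M v =>
    (∀ a, a ∈ M → ∀ b, b ∈ M → ∀ b', b' ∈ M → pair a b ∈ v 1 → pair a b' ∈ v 1 → b = b') ∧
    ∀ b, b ∈ M → (b = v 0 ∨ b ∈ v 0) → ∃ a, a ∈ v 2 ∧ pair a b ∈ v 1) hμ hq ![l] (by simpa)
    (fun η hη => by
      obtain ⟨F, hF, hu, hFe⟩ := Cov.succ hM hl (mem_of_mem hM hμ hη) hll (hω omega_zero)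
        (hω (omega_succ omega_zero)) (hcov η hη)
      obtain ⟨e, he, hes, hee⟩ := exists_rel hM (k := 1) (fun _ v => pair (v 0) (v 1) ∈ v 2)
        hl hμ ![F] (by simpa)
      have hee : ∀ a b, pair a b ∈ e ↔ (a ∈ l ∧ b ∈ μ) ∧ pair a b ∈ F := hee
      refine ⟨e, (hq' e).2 ⟨he, hes⟩, fun a _ b _ b' _ h h' =>
        hu a b b' ((hee _ _).1 h).2 ((hee _ _).1 h').2, fun b _ hb => ?_⟩
      have hbμ : b ∈ μ := by
        rcases hb with hb | hb
        exacts [hb ▸ hη, ho.mem_trans hb hη]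
      obtain ⟨a, ha, hab⟩ := hFe b (mem_insert_iff.2 hb)
      exact ⟨a, ha, (hee _ _).2 ⟨⟨ha, hbμ⟩, hab⟩⟩)
  have hCP : ∀ η e, pair η e ∈ C →
      (∀ a, a ∈ M → ∀ b, b ∈ M → ∀ b', b' ∈ M → pair a b ∈ e → pair a b' ∈ e → b = b') ∧
      ∀ b, b ∈ M → (b = η ∨ b ∈ η) → ∃ a, a ∈ l ∧ pair a b ∈ e := hCP
  have hβl := prod_mem hM hβM hl
  have h₁ : Cov M l (prod β l) := hll.trans hM hl (prod_mem hM hl hl) hβl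
    ((hcov β hβ).prod hM hl hβM hl hl (Cov.of_subset hM hl fun _ h => h))
  refine CardinalIn.not_cov hM hc hμ hlμ (h₁.trans hM hl hβl hμ ?_)
  refine Cov.of_rel hM (k := 2) (fun M v => ∃ ξ, ξ ∈ M ∧ ∃ a, a ∈ M ∧ ∃ η, η ∈ M ∧ ∃ e, e ∈ M ∧
    v 0 = pair ξ a ∧ pair ξ η ∈ v 2 ∧ pair η e ∈ v 3 ∧ pair a (v 1) ∈ e) hβl hμ ![f, C]
    (forall_vec₂ hf hC) ?_ ?_
  · rintro p - b hb b' hb' ⟨ξ, -, a, ha, η, -, e, -, rfl, h₁, h₂, h₃⟩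
      ⟨ξ', -, a', -, η', -, e', -, he, h₁', h₂', h₃'⟩
    obtain ⟨rfl, rfl⟩ := pair_inj.1 he
    obtain rfl := IsFunc.eq hff h₁ h₁'
    obtain rfl := IsFunc.eq hCf h₂ h₂'
    exact (hCP _ _ h₂).1 a ha b (mem_of_mem hM hμ hb) b' (mem_of_mem hM hμ hb') h₃ h₃'
  · intro γ hγ
    obtain ⟨ξ, hξ, η, hξη, hγη⟩ := hfc γ hγ
    have hη := (pair_mem_prod.1 (hff.1 hξη)).2
    obtain ⟨e, he, hηe⟩ := IsFunc.exists_eq hCf hη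
    obtain ⟨a, ha, hae⟩ := (hCP _ _ hηe).2 γ (mem_of_mem hM hμ hγ) hγη.symm
    exact ⟨pair ξ a, pair_mem_prod.2 ⟨hξ, ha⟩, ξ, mem_of_mem hM hβM hξ, a, mem_of_mem hM hl ha,
      η, mem_of_mem hM hμ hη, e, mem_of_mem hM hq he, rfl, hξη, hηe, hae⟩

end ZFModel

namespace ZFModel

universe u

variable {M N : Set ZFSet.{u}}

open ZFSet

theorem cardinalIn_of_regularIn {μ : ZFSet.{u}} (ho : μ.IsOrdinal) (h : RegularIn M μ) :
    CardinalIn M μ :=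
  ⟨ho, fun β hβ ⟨f, hf, hff, hs⟩ => h β hβ f hf hff fun γ hγ =>
    let ⟨ξ, hξ, h⟩ := hs γ hγ
    ⟨ξ, hξ, γ, h, Or.inr rfl⟩⟩

end ZFModel

/-- in the proof of the Kunen-style theorem, with `j : M → N` elementary,
amenable, with bounded critical sequence, between transitive ZFC models with the same
ordinals which agree on regularity, the supremum `λ` of the critical sequence has
cofinality `ω` in both models, and both `λ` and `(λ⁺)^M` are fixed by `j`. -/
theorem stmt17 (M N : Set ZFSet) (hM : IsZFCModel M) (hN : IsZFCModel N)
    (hOrd : SameOrdinals M N) (j : ↥M ↪ₑ[ZFLang] ↥N)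
    (hnt : ∃ x : ↥M, ((j x : ↥N) : ZFSet) ≠ (x : ZFSet))
    (hamen : Amenable M N ⇑j)
    (hreg : ∀ α : ZFSet, α ∈ M → RegularIn M α → RegularIn N α)
    (c : ℕ → ZFSet) (hcord : ∀ n, (c n).IsOrdinal ∧ c n ∈ M)
    (hc0 : IsCrit M N (⇑j) (c 0))
    (hcrec : ∀ n (h : c n ∈ M), ((j ⟨c n, h⟩ : ↥N) : ZFSet) = c (n + 1))
    (hbd : ∃ b : ZFSet, b.IsOrdinal ∧ b ∈ M ∧ ∀ n, c n ∈ b)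
    (lam : ZFSet) (hlam : lam.IsOrdinal) (hlamM : lam ∈ M)
    (hsup₁ : ∀ n, c n ∈ lam)
    (hsup₂ : ∀ β, β ∈ lam → ∃ n, β ∈ c n ∨ β = c n) :
    CofOmegaIn M lam ∧ CofOmegaIn N lam ∧
      ((j ⟨lam, hlamM⟩ : ↥N) : ZFSet) = lam ∧
      ∀ μ (hμ : IsCardSuccIn M lam μ), ((j ⟨μ, hμ.1⟩ : ↥N) : ZFSet) = μ := by
  classical
  let J : ZFSet → ZFSet := fun x => if h : x ∈ M then j ⟨x, h⟩ else ∅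
  have hJj : ∀ (x : ZFSet) (h : x ∈ M), J x = j ⟨x, h⟩ := fun x h => dif_pos h
  have hJ : ZFModel.Elem M N J :=
    ZFModel.elem_of_elementaryEmbedding hM hN j fun x => hJj x x.2
  have hlamN := (hOrd lam hlam).1 hlamM
  have hJc : ∀ n, J (c n) = c (n + 1) := fun n =>
    (hJj _ (hcord n).2).trans (hcrec n (hcord n).2)
  have hJo : ∀ x ∈ M, x.IsOrdinal → x ∈ J x ∨ x = J x := fun x hx ho => by
    rcases ho.mem_trichotomous ((hJ.isOrdinal_iff hx).2 ho) with h | h | h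
    exacts [Or.inl h, Or.inr h, absurd h (hJ.notMem_self ho hx)]
  have hmoved : J (c 0) ≠ c 0 := by
    obtain ⟨-, h, hne, -⟩ := hc0
    rwa [hJj _ h]
  have hclt : ∀ n, c n ∈ c (n + 1) := by
    intro n
    induction n with
    | zero =>
      rw [← hJc]
      exact (hJo _ (hcord 0).2 (hcord 0).1).resolve_right hmoved.symm
    | succ n ih =>
      rw [← hJc n, ← hJc (n + 1)]
      exact (hJ.mem_iff (hcord n).2 (hcord (n + 1)).2).2 ih
  have hω : ZFSet.omega ∈ c 0 := by
    rcases ZFModel.isOrdinal_omega.mem_trichotomous (hcord 0).1 with h | h | h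
    · exact h
    · exact absurd (h ▸ hJ.map_omega) hmoved
    · exact absurd (hJ.map_of_mem_omega h) hmoved
  have hωl : ZFSet.omega ⊆ lam := hlam.subset_of_mem (hlam.mem_trans hω (hsup₁ 0))
  have hlt : ∀ x ∈ lam, ∃ n, x ∈ c n := fun x hx => by
    obtain ⟨n, h | rfl⟩ := hsup₂ x hx
    exacts [⟨n, h⟩, ⟨n + 1, hclt n⟩]
  have hlM : ∀ {x}, x ∈ lam → x ∈ M := fun hx => ZFModel.mem_of_mem hM hlamM hx
  have hls : ∀ x ∈ lam, insert x x ∈ lam := by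
    intro x hx
    obtain ⟨n, hn⟩ := hlt x hx
    rcases (ZFSet.isOrdinal_succ (hlam.mem hx)).mem_trichotomous hlam with h | h | h
    · exact h
    · have hcn := h ▸ hsup₁ n
      rcases ZFSet.mem_insert_iff.1 hcn with h' | h'
      exacts [absurd (h' ▸ hn) (ZFSet.mem_irrefl _), absurd hn (ZFSet.mem_asymm h')]
    · rcases ZFSet.mem_insert_iff.1 h with h' | h'
      exacts [absurd (h' ▸ hx) (ZFSet.mem_irrefl _), absurd hx (ZFSet.mem_asymm h')]
  have hJl : ∀ x ∈ lam, J x ∈ lam := by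
    intro x hx
    obtain ⟨n, hn⟩ := hlt x hx
    refine hlam.mem_trans ?_ (hsup₁ (n + 1))
    rw [← hJc]
    exact (hJ.mem_iff (hlM hx) (hcord n).2).2 hn
  obtain ⟨z, hz, hzl⟩ := hamen lam hlamM
  have hzl : ∀ w, w ∈ z ↔ ∃ y ∈ lam, J y = w := by
    intro w
    refine (hzl w).trans ⟨?_, ?_⟩
    · rintro ⟨y, hy, rfl⟩
      exact ⟨y, hy, hJj y y.2⟩
    · rintro ⟨y, hy, rfl⟩
      exact ⟨⟨y, hlM hy⟩, hy, (hJj y (hlM hy)).symm⟩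
  obtain ⟨F, hF, hFl⟩ := hJ.exists_restrict hlamM hlam.isTransitive hlamN hz hzl
  have hcN : CofOmegaIn N lam := by
    obtain ⟨s, hs, hsf, hsc⟩ := ZFModel.exists_iterate hN hlamN hF hsup₁ (fun n y => by
      rw [hFl, ← hJc]
      constructor
      · rintro ⟨x, -, he⟩
        obtain ⟨h₁, rfl⟩ := ZFSet.pair_inj.1 he
        rw [h₁]
      · rintro rfl
        exact ⟨_, hsup₁ n, rfl⟩)
    refine ⟨s, hs, hsf, fun γ hγ => ?_⟩
    obtain ⟨n, hn⟩ := hsup₂ γ hγ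
    exact ⟨_, ZFModel.mem_omega_iff_numeral.2 ⟨n, rfl⟩, c n, (hsc n _).2 rfl, hn⟩
  have hcM : CofOmegaIn M lam := ZFModel.cofOmegaIn_of_regular hM hN hlamM hlamN hlam
    (hωl ZFSet.omega_zero) hls (fun f hf hfl => hJ.rel_mem hlamM hlamN hF hFl hf hfl) hreg hcN
  have hfix : J lam = lam := by
    refine ((hJo lam hlamM hlam).resolve_left fun hmem => ?_).symm
    obtain ⟨f, hf, hff, hfc⟩ := hcM
    have hωM := ZFModel.omega_mem hM
    have hJf := (hJ.isFunc_iff hωM hlamM hf).2 hff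
    have hJfc := (hJ.cofinalIn_iff hωM hlamM hf).2 hfc
    rw [hJ.map_omega] at hJf hJfc
    obtain ⟨ξ, hξ, η, hξη, hη⟩ := hJfc lam hmem
    obtain ⟨y, hy, hξy⟩ := ZFModel.IsFunc.exists_eq hff hξ
    have h := (hJ.mem_iff (ZFModel.mem_of_mem hM hf hξy) hf).2 hξy
    rw [hJ.map_pair (ZFModel.mem_of_mem hM hωM hξ) (hlM hy), hJ.map_of_mem_omega hξ] at h
    obtain rfl := ZFModel.IsFunc.eq hJf h hξη
    rcases hη with h | h
    exacts [ZFSet.mem_asymm h (hJl y hy), ZFSet.mem_irrefl _ (h ▸ hJl y hy)]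
  refine ⟨hcM, hcN, hJj lam hlamM ▸ hfix, fun μ hμ => ?_⟩
  have hμo := hμ.2.1.1
  rw [← hJj μ hμ.1]
  refine ((hJo μ hμ.1 hμo).resolve_left fun hmem => ?_).symm
  have hsucc := (hJ.isCardSuccIn_iff hlamM hμ.1).2 hμ
  rw [hfix] at hsucc
  exact hsucc.2.2.2 μ hmem hμ.2.2.1 (ZFModel.cardinalIn_of_regularIn hμo
    (hreg μ hμ.1 (ZFModel.regularIn_of_isCardSuccIn hM hωl hμ)))
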